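/- arXiv:2410.21460 — 3 statements merged into one kernel-verified Lean document; each statement's English description precedes it below -/
import Mathlib

section
/- Let f ∈ Homeo¹(ℝ²). Then for every p ∈ ℝ², f induces a homeomorphism of projective tangent spaces at p: there exists a homeomorphism φ_p : ℙ(ℝ²) → ℙ(ℝ²) such that for every simple closed C¹ curve Γ through p with tangent line ℓ at p, the curve f(Γ) has tangent line φ_p(ℓ) at f(p). -/
open Filter Topology

noncomputable section

abbrev Plane : Type := ℝ × ℝ

abbrev ProjLine : Type := Projectivization ℝ Plane

instance : TopologicalSpace ProjLine := instTopologicalSpaceQuotient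

/-- A regular (C¹, 1-periodic, injective on `[0,1)`, nowhere-vanishing derivative)
parameterization of a simple closed C¹ curve. -/
def IsRegParam (γ : ℝ → Plane) : Prop :=
  ContDiff ℝ 1 γ ∧ Function.Periodic γ 1 ∧ Set.InjOn γ (Set.Ico 0 1) ∧ ∀ t, deriv γ t ≠ 0

/-- `Γ` is a simple closed C¹ curve. -/
def IsC1Curve (Γ : Set Plane) : Prop := ∃ γ : ℝ → Plane, IsRegParam γ ∧ Γ = Set.range γ

/-- `Γ` is a simple closed C¹ curve through `p` with tangent line `ℓ` at `p`. -/
def TangentAt (Γ : Set Plane) (p : Plane) (ℓ : ProjLine) : Prop :=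
  ∃ (γ : ℝ → Plane) (t₀ : ℝ) (h : IsRegParam γ),
    Γ = Set.range γ ∧ γ t₀ = p ∧ ℓ = Projectivization.mk ℝ (deriv γ t₀) (h.2.2.2 t₀)

/-- `f` maps every simple closed C¹ curve to a simple closed C¹ curve. -/
def MapsC1 (f : Plane → Plane) : Prop := ∀ Γ : Set Plane, IsC1Curve Γ → IsC1Curve (f '' Γ)

/-- Membership in `Homeo¹(ℝ²)`. -/
def InHomeo1 (f : Plane ≃ₜ Plane) : Prop := MapsC1 ⇑f ∧ MapsC1 ⇑f.symm

/-- `φ` is a homeomorphism of projective tangent spaces induced by `f` at `p`. -/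
def InducesAt (f : Plane → Plane) (p : Plane) (φ : ProjLine ≃ₜ ProjLine) : Prop :=
  ∀ (Γ : Set Plane) (ℓ : ProjLine), TangentAt Γ p ℓ →
    IsC1Curve (f '' Γ) ∧ TangentAt (f '' Γ) (f p) (φ ℓ)

/-- The secant direction from `q` to `x` (junk value if `x = q`). -/
def secantDir (q x : Plane) : ProjLine :=
  if h : x = q then Projectivization.mk ℝ (1, 0) (by simp) else
    Projectivization.mk ℝ (x - q) (sub_ne_zero.mpr h)

/-- The sequence `x` converges along the line `ℓ` to `p`. -/
def ConvAlong (p : Plane) (ℓ : ProjLine) (x : ℕ → Plane) : Prop :=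
  (∀ n, x n ≠ p) ∧ Tendsto x atTop (𝓝 p) ∧
    Tendsto (fun n => secantDir p (x n)) atTop (𝓝 ℓ)

/-- `(x, k)` is a transverse sequence for `(p, ℓ)`. -/
def TransverseFor (p : Plane) (ℓ : ProjLine) (x : ℕ → Plane) (k : ℕ → ProjLine) : Prop :=
  ConvAlong p ℓ x ∧
    ∀ φ : ℕ → ℕ, StrictMono φ →
      ¬ Tendsto (fun n => (x (φ n), k (φ n))) atTop (𝓝 (p, ℓ))

/-- `(x, k)` is a transverse sequence. -/
def Transverse (x : ℕ → Plane) (k : ℕ → ProjLine) : Prop := ∃ p ℓ, TransverseFor p ℓ x k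

/-! ### Topology of the projective line -/

namespace ProjLine

theorem isQuotientMap_mk' :
    IsQuotientMap (Projectivization.mk' ℝ : {v : Plane // v ≠ 0} → ProjLine) :=
  isQuotientMap_quotient_mk'

theorem continuous_mk {X : Type*} [TopologicalSpace X] {g : X → Plane} (hg : Continuous g)
    (h : ∀ x, g x ≠ 0) : Continuous fun x => Projectivization.mk ℝ (g x) (h x) :=
  isQuotientMap_mk'.continuous.comp (hg.subtype_mk h)

theorem mk_smul {c : ℝ} {v : Plane} (hc : c • v ≠ 0) (hv : v ≠ 0) :
    Projectivization.mk ℝ (c • v) hc = Projectivization.mk ℝ v hv :=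
  (Projectivization.mk_eq_mk_iff' ℝ _ _ hc hv).2 ⟨c, rfl⟩

theorem sq_add_sq_pos {v : Plane} (hv : v ≠ 0) : 0 < v.1 ^ 2 + v.2 ^ 2 := by
  by_contra! h
  exact hv (Prod.ext (by simp; nlinarith [sq_nonneg v.1, sq_nonneg v.2])
    (by simp; nlinarith [sq_nonneg v.1, sq_nonneg v.2]))

instance : CompactSpace ProjLine := by
  have h0 : ∀ x : Metric.sphere (0 : Plane) 1, (x : Plane) ≠ 0 :=
    fun x => ne_zero_of_mem_unit_sphere x
  have hs : Function.Surjective fun x : Metric.sphere (0 : Plane) 1 =>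
      Projectivization.mk ℝ (x : Plane) (h0 x) := by
    intro m
    induction m using Projectivization.ind with
    | h v hv =>
      refine ⟨⟨‖v‖⁻¹ • v, ?_⟩, mk_smul _ hv⟩
      simp [norm_smul, norm_ne_zero_iff.2 hv]
  exact hs.compactSpace (continuous_mk continuous_subtype_val h0)

/-- The first row of the matrix of the orthogonal projection onto a line. -/
def projMatrixRow : ProjLine → Plane :=
  Projectivization.lift
    (fun v => ((v.1.1 ^ 2 / (v.1.1 ^ 2 + v.1.2 ^ 2), v.1.1 * v.1.2 / (v.1.1 ^ 2 + v.1.2 ^ 2))))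
    (by
      rintro ⟨a, ha⟩ ⟨b, hb⟩ c rfl
      have hc : c ≠ 0 := by rintro rfl; simp at ha
      have := sq_add_sq_pos ha
      have := sq_add_sq_pos hb
      simp only [Prod.smul_fst, Prod.smul_snd, smul_eq_mul] at *
      ext
      · simp only []
        field_simp
      · simp only []
        field_simp)

theorem continuous_projMatrixRow : Continuous projMatrixRow := by
  rw [isQuotientMap_mk'.continuous_iff]
  change Continuous fun v : {v : Plane // v ≠ 0} =>
    ((v.1.1 ^ 2 / (v.1.1 ^ 2 + v.1.2 ^ 2), v.1.1 * v.1.2 / (v.1.1 ^ 2 + v.1.2 ^ 2)) : Plane)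
  have h : ∀ v : {v : Plane // v ≠ 0}, v.1.1 ^ 2 + v.1.2 ^ 2 ≠ 0 :=
    fun v => (sq_add_sq_pos v.2).ne'
  exact (Continuous.div (by fun_prop) (by fun_prop) h).prodMk
    (Continuous.div (by fun_prop) (by fun_prop) h)

theorem injective_projMatrixRow : Function.Injective projMatrixRow := by
  intro l m hlm
  induction l using Projectivization.ind with
  | h v hv =>
  induction m using Projectivization.ind with
  | h w hw =>
    simp only [projMatrixRow, Projectivization.lift_mk, Prod.mk.injEq] at hlm
    obtain ⟨h1, h2⟩ := hlm
    have pv := sq_add_sq_pos hv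
    have pw := sq_add_sq_pos hw
    rw [div_eq_div_iff pv.ne' pw.ne'] at h1 h2
    have hdet : v.1 * w.2 - v.2 * w.1 = 0 := by
      by_contra hd
      have h3 : (v.1 * w.2 + v.2 * w.1) * (v.1 * w.2 - v.2 * w.1) = 0 := by linear_combination h1
      have h3' := (mul_eq_zero.1 h3).resolve_right hd
      have h4 : (v.2 * w.2 - v.1 * w.1) * (v.1 * w.2 - v.2 * w.1) = 0 := by
        linear_combination h2
      have h4' := (mul_eq_zero.1 h4).resolve_right hd
      have e : w.1 * (v.1 ^ 2 + v.2 ^ 2) = 0 := by linear_combination v.2 * h3' - v.1 * h4'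
      have e' : w.2 * (v.1 ^ 2 + v.2 ^ 2) = 0 := by linear_combination v.1 * h3' + v.2 * h4'
      exact hw (Prod.ext ((mul_eq_zero.1 e).resolve_right pv.ne')
        ((mul_eq_zero.1 e').resolve_right pv.ne'))
    refine (Projectivization.mk_eq_mk_iff' ℝ _ _ hv hw).2
      ⟨(v.1 * w.1 + v.2 * w.2) / (w.1 ^ 2 + w.2 ^ 2), Prod.ext ?_ ?_⟩
    · simp only [Prod.smul_fst, smul_eq_mul]
      field_simp
      linear_combination -w.2 * hdet
    · simp only [Prod.smul_snd, smul_eq_mul]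
      field_simp
      linear_combination w.1 * hdet

instance : T2Space ProjLine :=
  T2Space.of_injective_continuous injective_projMatrixRow continuous_projMatrixRow

end ProjLine

/-! ### Interpolation by a `C¹` function -/

/-- A rapidly decreasing sequence of nodes `s k → 0` with values that are `o(s k)` can be
interpolated by a `C¹` function. -/
theorem exists_contDiff_interpolation {s r : ℕ → ℝ} (hs : ∀ k, s k ≠ 0)
    (hs' : ∀ k, |s (k + 1)| ≤ |s k| / 2) (hr : ∀ k, |r k| ≤ (1 / 2) ^ k * |s k|) :
    ∃ h : ℝ → ℝ, ContDiff ℝ 1 h ∧ h 0 = 0 ∧ ∀ k, h (s k) = r k := by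
  let χ : ContDiffBump (1 : ℝ) := ⟨1 / 4, 1 / 2, by norm_num, by norm_num⟩
  have hχ0 : ∀ x : ℝ, 1 / 2 ≤ |x - 1| → χ x = 0 := fun x hx => χ.zero_of_le_dist hx
  have hχ1 : χ (1 : ℝ) = 1 := χ.one_of_mem_closedBall (by simp [χ])
  have hχd : Differentiable ℝ χ := (χ.contDiff (n := 1)).differentiable one_ne_zero
  have hχc : Continuous (deriv χ) := (χ.contDiff (n := 1)).continuous_deriv le_rfl
  obtain ⟨C, hC⟩ := χ.hasCompactSupport.deriv.exists_bound_of_continuous hχc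
  have hsum : Summable fun k : ℕ => (1 / 2 : ℝ) ^ k * C :=
    (summable_geometric_of_lt_one (by norm_num) (by norm_num)).mul_right C
  have hbound : ∀ k y, ‖r k * (deriv χ (y / s k) * (1 / s k))‖ ≤ (1 / 2 : ℝ) ^ k * C := by
    intro k y
    have h0 := abs_pos.2 (hs k)
    calc ‖r k * (deriv χ (y / s k) * (1 / s k))‖ = (|r k| / |s k|) * ‖deriv χ (y / s k)‖ := by
          simp only [norm_mul, Real.norm_eq_abs, abs_div, abs_one]
          ring
      _ ≤ (1 / 2 : ℝ) ^ k * C := by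
          gcongr
          · rw [div_le_iff₀ h0]; exact hr k
          · exact hC _
  have hderiv : ∀ k y, HasDerivAt (fun x => r k * χ (x / s k))
      (r k * (deriv χ (y / s k) * (1 / s k))) y := fun k y =>
    (HasDerivAt.comp (h := fun x => x / s k) y (hχd (y / s k)).hasDerivAt
      ((hasDerivAt_id y).div_const (s k))).const_mul (r k)
  have hzero : ∀ k, r k * χ (0 / s k) = 0 := fun k => by
    rw [zero_div, hχ0 0 (by norm_num), mul_zero]
  have hD : ∀ y, HasDerivAt (fun x => ∑' k, r k * χ (x / s k))
      (∑' k, r k * (deriv χ (y / s k) * (1 / s k))) y :=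
    hasDerivAt_tsum (y₀ := 0) hsum hderiv hbound (by simpa only [hzero] using summable_zero)
  have hle : ∀ j n, |s (j + n + 1)| ≤ |s j| / 2 := by
    intro j n
    induction n with
    | zero => exact hs' j
    | succ n ih =>
      have := hs' (j + n + 1)
      have := abs_nonneg (s (j + n + 1))
      rw [← add_assoc]
      linarith
  have hlt : ∀ {j k}, j < k → |s k| ≤ |s j| / 2 := by
    intro j k hjk
    obtain ⟨n, rfl⟩ := Nat.exists_eq_add_of_lt hjk
    exact hle j n
  refine ⟨fun x => ∑' k, r k * χ (x / s k), ?_, by simp only [hzero, tsum_zero], fun j => ?_⟩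
  · rw [contDiff_one_iff_deriv]
    refine ⟨fun y => (hD y).differentiableAt, ?_⟩
    rw [funext fun y => (hD y).deriv]
    exact continuous_tsum (fun k => by fun_prop) hsum hbound
  · simp only
    rw [tsum_eq_single j, div_self (hs j), hχ1, mul_one]
    intro k hkj
    rw [hχ0, mul_zero]
    have hk := abs_pos.2 (hs k)
    rcases lt_or_gt_of_ne hkj with h | h
    · have h1 : |s j / s k| ≤ 1 / 2 := by
        rw [abs_div, div_le_iff₀ hk]; linarith [hlt h]
      rw [abs_sub_comm]
      have := (abs_le.1 h1).2
      exact le_trans (by linarith) (le_abs_self _)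
    · have h1 : 2 ≤ |s j / s k| := by
        rw [abs_div, le_div_iff₀ hk]; linarith [hlt h]
      have := abs_sub_abs_le_abs_sub (s j / s k) 1
      rw [abs_one] at this
      linarith

/-! ### Star-shaped loops -/

/-- A vector orthogonal to `v`. -/
def rotVec (v : Plane) : Plane := (v.2, -v.1)

/-- The loop through `p` given in polar coordinates around `p - rotVec v` by the
radius `exp (h (sin θ))`. -/
def polarLoop (p v : Plane) (h : ℝ → ℝ) (t : ℝ) : Plane :=
  p - rotVec v + ((Real.exp (h (Real.sin (2 * Real.pi * t))) * Real.cos (2 * Real.pi * t)) • rotVec v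
    + (Real.exp (h (Real.sin (2 * Real.pi * t))) * Real.sin (2 * Real.pi * t)) • v)

theorem rotVec_smul_add_smul_injective {v : Plane} (hv : v ≠ 0) {a b a' b' : ℝ}
    (h : a • rotVec v + b • v = a' • rotVec v + b' • v) : a = a' ∧ b = b' := by
  have pv := ProjLine.sq_add_sq_pos hv
  have h1 := congrArg Prod.fst h
  have h2 := congrArg Prod.snd h
  simp only [rotVec, Prod.fst_add, Prod.snd_add, Prod.smul_fst, Prod.smul_snd, smul_eq_mul]
    at h1 h2
  refine ⟨mul_right_cancel₀ pv.ne' ?_, mul_right_cancel₀ pv.ne' ?_⟩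
  · linear_combination v.2 * h1 - v.1 * h2
  · linear_combination v.1 * h1 + v.2 * h2

theorem isRegParam_polarLoop (p : Plane) {v : Plane} (hv : v ≠ 0) {h : ℝ → ℝ}
    (hh : ContDiff ℝ 1 h) : IsRegParam (polarLoop p v h) := by
  refine ⟨?_, ?_, ?_, ?_⟩
  · unfold polarLoop
    fun_prop
  · intro t
    simp only [polarLoop, mul_add, mul_one, Real.sin_add_two_pi, Real.cos_add_two_pi]
  · intro t ht t' ht' e
    obtain ⟨e1, e2⟩ := rotVec_smul_add_smul_injective hv (add_left_cancel e)
    set R := Real.exp (h (Real.sin (2 * Real.pi * t)))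
    set R' := Real.exp (h (Real.sin (2 * Real.pi * t')))
    have hR : 0 < R := Real.exp_pos _
    have hR' : 0 < R' := Real.exp_pos _
    have hsq : R ^ 2 = R' ^ 2 := by
      have c1 := Real.sin_sq_add_cos_sq (2 * Real.pi * t)
      have c2 := Real.sin_sq_add_cos_sq (2 * Real.pi * t')
      calc R ^ 2 = (R * Real.cos (2 * Real.pi * t)) ^ 2 + (R * Real.sin (2 * Real.pi * t)) ^ 2 := by
            linear_combination (-R ^ 2) * c1
        _ = R' ^ 2 := by rw [e1, e2]; linear_combination R' ^ 2 * c2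
    have hRR : R = R' := by rwa [sq_eq_sq₀ hR.le hR'.le] at hsq
    rw [hRR] at e1 e2
    have ha := Real.Angle.cos_sin_inj (mul_left_cancel₀ hR'.ne' e1) (mul_left_cancel₀ hR'.ne' e2)
    obtain ⟨n, hn⟩ := Real.Angle.angle_eq_iff_two_pi_dvd_sub.1 ha
    have hn' : t - t' = n := by
      have := Real.pi_pos
      have h2 : (2 * Real.pi) * (t - t') = (2 * Real.pi) * n := by linear_combination hn
      exact mul_left_cancel₀ (by positivity) h2
    have n1 : (n : ℝ) < 1 := by rw [← hn']; linarith [ht.2, ht'.1]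
    have n2 : (-1 : ℝ) < n := by rw [← hn']; linarith [ht.1, ht'.2]
    have n0 : n = 0 := by
      have : n < 1 := by exact_mod_cast n1
      have : -1 < n := by exact_mod_cast n2
      omega
    rw [n0, Int.cast_zero] at hn'
    linarith
  · intro t
    have hR : DifferentiableAt ℝ (fun t => Real.exp (h (Real.sin (2 * Real.pi * t)))) t := by
      have : Differentiable ℝ h := hh.differentiable one_ne_zero
      fun_prop
    obtain ⟨R', hR'⟩ : ∃ R', HasDerivAt (fun t => Real.exp (h (Real.sin (2 * Real.pi * t)))) R' t :=
      ⟨_, hR.hasDerivAt⟩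
    have hl : HasDerivAt (fun t => 2 * Real.pi * t) (2 * Real.pi) t := by
      simpa using (hasDerivAt_id t).const_mul (2 * Real.pi)
    have hd := (((hR'.mul hl.cos).smul_const (rotVec v)).add
      ((hR'.mul hl.sin).smul_const v)).const_add (p - rotVec v)
    have hd' : deriv (polarLoop p v h) t = _ := hd.deriv
    rw [hd']
    intro e
    obtain ⟨e1, e2⟩ := rotVec_smul_add_smul_injective hv (a' := 0) (b' := 0) (by simpa using e)
    have c1 := Real.sin_sq_add_cos_sq (2 * Real.pi * t)
    have : Real.exp (h (Real.sin (2 * Real.pi * t))) * (2 * Real.pi) = 0 := by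
      linear_combination Real.cos (2 * Real.pi * t) * e2 - Real.sin (2 * Real.pi * t) * e1
        - Real.exp (h (Real.sin (2 * Real.pi * t))) * (2 * Real.pi) * c1
    exact mul_ne_zero (Real.exp_pos _).ne' Real.two_pi_pos.ne' this

/-- Through every point there is a simple closed `C¹` curve with prescribed tangent line. -/
theorem exists_tangentAt (p : Plane) (l : ProjLine) : ∃ Γ, TangentAt Γ p l := by
  induction l using Projectivization.ind with
  | h v hv =>
    have hreg := isRegParam_polarLoop p hv (h := fun _ => 0) contDiff_const
    refine ⟨_, polarLoop p v fun _ => 0, 0, hreg, rfl, by simp [polarLoop], ?_⟩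
    have hl : HasDerivAt (fun t => 2 * Real.pi * t) (2 * Real.pi) 0 := by
      simpa using (hasDerivAt_id (0 : ℝ)).const_mul (2 * Real.pi)
    have hd := ((hl.cos.smul_const (rotVec v)).add (hl.sin.smul_const v)).const_add (p - rotVec v)
    have hd' : deriv (polarLoop p v fun _ => 0) 0 = (2 * Real.pi) • v := by
      have e : polarLoop p v (fun _ => 0) = fun t => p - rotVec v +
          (Real.cos (2 * Real.pi * t) • rotVec v + Real.sin (2 * Real.pi * t) • v) := by
        funext t; simp [polarLoop]
      rw [e]
      refine hd.deriv.trans ?_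
      simp
    simp only [hd']
    exact (ProjLine.mk_smul _ hv).symm

/-! ### Converging to a point along a direction -/

/-- The filter of points converging to `p` along the line `l`. -/
def dirFilter (p : Plane) (l : ProjLine) : Filter Plane :=
  𝓝[≠] p ⊓ comap (secantDir p) (𝓝 l)

theorem tendsto_dirFilter {X : Type*} {F : Filter X} {g : X → Plane} {p : Plane} {l : ProjLine} :
    Tendsto g F (dirFilter p l) ↔
      Tendsto g F (𝓝[≠] p) ∧ Tendsto (fun x => secantDir p (g x)) F (𝓝 l) := by
  simp only [dirFilter, tendsto_inf, tendsto_comap_iff, Function.comp_def]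

theorem tendsto_secantDir_dirFilter (p : Plane) (l : ProjLine) :
    Tendsto (secantDir p) (dirFilter p l) (𝓝 l) :=
  (tendsto_dirFilter.1 tendsto_id).2

theorem secantDir_eq_mk_smul {p x : Plane} {c : ℝ} (h : c • (x - p) ≠ 0) :
    secantDir p x = Projectivization.mk ℝ (c • (x - p)) h := by
  have hx : x ≠ p := by rintro rfl; simp at h
  rw [secantDir, dif_neg hx, ProjLine.mk_smul]

namespace IsRegParam

variable {γ : ℝ → Plane}

theorem eq_of_abs_sub_lt {t t₀ : ℝ} (h : IsRegParam γ) (ht : |t - t₀| < 1) (e : γ t = γ t₀) :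
    t = t₀ := by
  have hf : ∀ s, γ (Int.fract s) = γ s := fun s => by
    have hp : Function.Periodic γ 1 := h.2.1
    have hs := hp.sub_zsmul_eq ⌊s⌋ (x := s)
    rwa [zsmul_one] at hs
  have e' := h.2.2.1 ⟨Int.fract_nonneg t, Int.fract_lt_one t⟩
    ⟨Int.fract_nonneg t₀, Int.fract_lt_one t₀⟩ (by rw [hf, hf, e])
  obtain ⟨n, hn⟩ := Int.fract_eq_fract.1 e'
  rw [hn] at ht
  have n0 : n = 0 := by
    rw [← Int.abs_lt_one_iff]
    exact_mod_cast ht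
  rw [n0, Int.cast_zero] at hn
  linarith

theorem tendsto_dirFilter (h : IsRegParam γ) (t₀ : ℝ) : Tendsto γ (𝓝[≠] t₀)
    (dirFilter (γ t₀) (Projectivization.mk ℝ (deriv γ t₀) (h.2.2.2 t₀))) := by
  have hd : HasDerivAt γ (deriv γ t₀) t₀ :=
    (h.1.differentiable one_ne_zero t₀).hasDerivAt
  have hne : ∀ᶠ t in 𝓝[≠] t₀, γ t ≠ γ t₀ := hd.eventually_ne (h.2.2.2 t₀)
  refine _root_.tendsto_dirFilter.2 ⟨tendsto_nhdsWithin_iff.2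
    ⟨hd.continuousAt.tendsto.mono_left nhdsWithin_le_nhds, hne⟩, ?_⟩
  have hs := hasDerivAt_iff_tendsto_slope.1 hd
  rw [tendsto_def] at hs ⊢
  intro W hW
  have hW' : ∀ᶠ w in 𝓝 (deriv γ t₀), ∀ hw : w ≠ 0, Projectivization.mk ℝ w hw ∈ W := by
    have hc := (ProjLine.isQuotientMap_mk'.continuous.continuousAt
      (x := ⟨deriv γ t₀, h.2.2.2 t₀⟩)).preimage_mem_nhds hW
    rw [nhds_subtype_eq_comap, mem_comap] at hc
    obtain ⟨V, hV, hVW⟩ := hc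
    filter_upwards [hV] with w hwV hw
    exact hVW (show (⟨w, hw⟩ : {v : Plane // v ≠ 0}) ∈ _ from hwV)
  filter_upwards [hs _ hW', hne, self_mem_nhdsWithin] with t ht htne htt
  have h0 : (t - t₀)⁻¹ • (γ t - γ t₀) ≠ 0 :=
    smul_ne_zero (inv_ne_zero (sub_ne_zero.2 htt)) (sub_ne_zero.2 htne)
  simp only [Set.mem_preimage]
  rw [secantDir_eq_mk_smul h0]
  exact ht h0

end IsRegParam

theorem TangentAt.nhdsWithin_le {Γ : Set Plane} {p : Plane} {l : ProjLine}
    (h : TangentAt Γ p l) : 𝓝[Γ \ {p}] p ≤ dirFilter p l := by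
  obtain ⟨γ, t₀, h, rfl, rfl, rfl⟩ := h
  intro W hW
  obtain ⟨δ, hδ, hδW⟩ := Metric.mem_nhdsWithin_iff.1 (h.tendsto_dirFilter t₀ hW)
  have hK : IsCompact (γ '' (Set.Icc (t₀ - 1 / 2) (t₀ + 1 / 2) \ Metric.ball t₀ δ)) :=
    (isCompact_Icc.diff Metric.isOpen_ball).image h.1.continuous
  have hp : γ t₀ ∉ γ '' (Set.Icc (t₀ - 1 / 2) (t₀ + 1 / 2) \ Metric.ball t₀ δ) := by
    rintro ⟨t, ⟨ht, htδ⟩, e⟩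
    have := h.eq_of_abs_sub_lt (abs_lt.2 ⟨by linarith [ht.1], by linarith [ht.2]⟩) e
    exact htδ (this ▸ Metric.mem_ball_self hδ)
  filter_upwards [mem_nhdsWithin_of_mem_nhds (hK.isClosed.isOpen_compl.mem_nhds hp),
    self_mem_nhdsWithin] with x hx hxΓ
  obtain ⟨⟨t', rfl⟩, hne⟩ := hxΓ
  obtain ⟨t, ht, e⟩ := h.2.1.exists_mem_Ico one_pos t' (t₀ - 1 / 2)
  rw [e] at hx hne ⊢
  have htδ : t ∈ Metric.ball t₀ δ := by
    by_contra hn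
    exact hx ⟨t, ⟨⟨ht.1, by linarith [ht.2]⟩, hn⟩, rfl⟩
  exact hδW ⟨htδ, fun e' => hne (by rw [Set.mem_singleton_iff.1 e']; rfl)⟩

theorem TangentAt.nhdsWithin_neBot {Γ : Set Plane} {p : Plane} {l : ProjLine}
    (h : TangentAt Γ p l) : (𝓝[Γ \ {p}] p).NeBot := by
  obtain ⟨γ, t₀, h, rfl, rfl, -⟩ := h
  have ht := (tendsto_dirFilter.1 (h.tendsto_dirFilter t₀)).1
  rw [tendsto_nhdsWithin_iff] at ht
  have ht' : Tendsto γ (𝓝[≠] t₀) (𝓝[Set.range γ \ {γ t₀}] γ t₀) :=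
    tendsto_nhdsWithin_iff.2 ⟨ht.1, ht.2.mono fun t hne => ⟨⟨t, rfl⟩, hne⟩⟩
  exact ht'.neBot

instance dirFilter_neBot (p : Plane) (l : ProjLine) : (dirFilter p l).NeBot := by
  obtain ⟨Γ, hΓ⟩ := exists_tangentAt p l
  exact hΓ.nhdsWithin_neBot.mono hΓ.nhdsWithin_le

theorem IsC1Curve.exists_tangentAt {Γ : Set Plane} (h : IsC1Curve Γ) {p : Plane} (hp : p ∈ Γ) :
    ∃ l, TangentAt Γ p l := by
  obtain ⟨γ, hγ, rfl⟩ := h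
  obtain ⟨t, rfl⟩ := hp
  exact ⟨_, γ, t, hγ, rfl, rfl, rfl⟩

theorem TangentAt.isC1Curve {Γ : Set Plane} {p : Plane} {l : ProjLine} (h : TangentAt Γ p l) :
    IsC1Curve Γ := by
  obtain ⟨γ, t, hγ, e, -⟩ := h
  exact ⟨γ, hγ, e⟩

theorem TangentAt.mem {Γ : Set Plane} {p : Plane} {l : ProjLine} (h : TangentAt Γ p l) :
    p ∈ Γ := by
  obtain ⟨γ, t, -, rfl, rfl, -⟩ := h
  exact ⟨t, rfl⟩

/-! ### Curves through points converging along a direction -/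

/-- The coordinate of `w` along `v`. -/
def coordAlong (v w : Plane) : ℝ := (w.1 * v.1 + w.2 * v.2) / (v.1 ^ 2 + v.2 ^ 2)

theorem coordAlong_smul_add {v : Plane} (hv : v ≠ 0) (w : Plane) :
    coordAlong (rotVec v) w • rotVec v + coordAlong v w • v = w := by
  have := ProjLine.sq_add_sq_pos hv
  have h2 : v.2 ^ 2 + v.1 ^ 2 ≠ 0 := by linarith
  ext <;> simp only [coordAlong, rotVec, Prod.fst_add, Prod.snd_add, Prod.smul_fst, Prod.smul_snd,
    smul_eq_mul, neg_sq] <;> field_simp <;> ring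

theorem coordAlong_const_smul (v : Plane) (c : ℝ) (w : Plane) :
    coordAlong v (c • w) = c * coordAlong v w := by
  simp only [coordAlong, Prod.smul_fst, Prod.smul_snd, smul_eq_mul]
  ring

theorem continuous_coordAlong (v : Plane) : Continuous (coordAlong v) := by
  unfold coordAlong
  fun_prop

theorem coordAlong_rotVec_self (v : Plane) : coordAlong (rotVec v) v = 0 := by
  simp [coordAlong, rotVec, mul_comm]

theorem coordAlong_self {v : Plane} (hv : v ≠ 0) : coordAlong v v = 1 := by
  rw [coordAlong, div_eq_one_iff_eq (ProjLine.sq_add_sq_pos hv).ne']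
  ring

/-- Along a direction, the transverse coordinate is negligible. -/
theorem eventually_coordAlong_lt (p : Plane) {v : Plane} (hv : v ≠ 0) {ε : ℝ} (hε : 0 < ε) :
    ∀ᶠ x in dirFilter p (Projectivization.mk ℝ v hv),
      |coordAlong (rotVec v) (x - p)| < ε * |coordAlong v (x - p)| := by
  let N : Set ProjLine := {m | |coordAlong (rotVec v) m.rep| < ε * |coordAlong v m.rep|}
  have hN : ∀ (w : Plane) (hw : w ≠ 0), Projectivization.mk ℝ w hw ∈ N ↔
      |coordAlong (rotVec v) w| < ε * |coordAlong v w| := by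
    intro w hw
    obtain ⟨c, hc⟩ := Projectivization.exists_smul_eq_mk_rep ℝ w hw
    have hc' : 0 < |(c : ℝ)| := abs_pos.2 c.ne_zero
    simp only [N, Set.mem_ofPred_eq, ← hc, Units.smul_def, coordAlong_const_smul, abs_mul]
    rw [mul_left_comm, mul_lt_mul_iff_right₀ hc']
  have hopen : IsOpen N := by
    rw [← ProjLine.isQuotientMap_mk'.isOpen_preimage]
    have : Projectivization.mk' ℝ ⁻¹' N = {w : {w : Plane // w ≠ 0} |
        |coordAlong (rotVec v) w| < ε * |coordAlong v w|} := by
      ext w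
      exact hN w.1 w.2
    rw [this]
    have c1 := continuous_coordAlong (rotVec v)
    have c2 := continuous_coordAlong v
    exact isOpen_lt (by fun_prop) (by fun_prop)
  have hmem : Projectivization.mk ℝ v hv ∈ N := by
    rw [hN, coordAlong_rotVec_self, coordAlong_self hv]
    simpa using hε
  have hne : ∀ᶠ x in dirFilter p (Projectivization.mk ℝ v hv), x ≠ p :=
    inf_le_left (a := 𝓝[≠] p) self_mem_nhdsWithin
  filter_upwards [tendsto_secantDir_dirFilter p _ (hopen.mem_nhds hmem), hne] with x hx hxp
  rw [Set.mem_preimage, secantDir, dif_neg hxp, hN] at hx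
  exact hx

/-- The position of `x` relative to `p - rotVec v`, in the basis `rotVec v, v`. -/
def centeredCoord (p v x : Plane) : ℂ :=
  ⟨1 + coordAlong (rotVec v) (x - p), coordAlong v (x - p)⟩

theorem mem_range_polarLoop {p v x : Plane} (hv : v ≠ 0) {h : ℝ → ℝ}
    (h0 : centeredCoord p v x ≠ 0)
    (hx : h ((centeredCoord p v x).im / ‖centeredCoord p v x‖) =
      Real.log ‖centeredCoord p v x‖) :
    x ∈ Set.range (polarLoop p v h) := by
  refine ⟨(centeredCoord p v x).arg / (2 * Real.pi), ?_⟩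
  have e : 2 * Real.pi * ((centeredCoord p v x).arg / (2 * Real.pi)) =
      (centeredCoord p v x).arg := by
    field_simp
  rw [polarLoop, e, Complex.sin_arg, hx, Real.exp_log (norm_pos_iff.2 h0), ← Complex.sin_arg,
    Complex.norm_mul_cos_arg, Complex.norm_mul_sin_arg]
  simp only [centeredCoord, add_smul, one_smul]
  rw [add_assoc, coordAlong_smul_add hv]
  abel

/-- A point near `1` which is close to the vertical line through `1` compared to its height
has logarithmic radius small compared to the sine of its argument. -/
theorem abs_log_norm_le {z : ℂ} {ε : ℝ} (hε : ε ≤ 1 / 16) (hre : |z.re - 1| < ε * |z.im|)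
    (him : |z.im| < ε) :
    z ≠ 0 ∧ z.im / ‖z‖ ≠ 0 ∧ |z.im / ‖z‖| ≤ 2 * ε ∧
      |Real.log ‖z‖| ≤ 8 * ε * |z.im / ‖z‖| := by
  have hi0 : 0 ≤ |z.im| := abs_nonneg _
  have hε0 : 0 < ε := hi0.trans_lt him
  have hi : 0 < |z.im| := by
    by_contra! hn
    have : |z.im| = 0 := le_antisymm hn hi0
    rw [this, mul_zero] at hre
    exact absurd hre (abs_nonneg _).not_gt
  have hz : z ≠ 0 := by rintro rfl; simp at hi
  have hn : 0 < ‖z‖ := norm_pos_iff.2 hz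
  have hN : ‖z‖ ^ 2 = z.re ^ 2 + z.im ^ 2 := by
    rw [Complex.sq_norm, Complex.normSq_apply]; ring
  have hd : |‖z‖ ^ 2 - 1| ≤ 4 * ε * |z.im| := by
    have e : ‖z‖ ^ 2 - 1 = (z.re - 1) * (2 + (z.re - 1)) + z.im * z.im := by rw [hN]; ring
    have h1 : |2 + (z.re - 1)| ≤ 3 := by
      refine (abs_add_le _ _).trans ?_
      rw [abs_two]
      nlinarith
    calc |‖z‖ ^ 2 - 1| ≤ |z.re - 1| * |2 + (z.re - 1)| + |z.im| * |z.im| := by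
          rw [e, ← abs_mul, ← abs_mul]; exact abs_add_le _ _
      _ ≤ ε * |z.im| * 3 + ε * |z.im| := by gcongr
      _ = 4 * ε * |z.im| := by ring
  have hsmall : 4 * ε * |z.im| ≤ 1 / 2 := by nlinarith
  obtain ⟨hd1, hd2⟩ := abs_le.1 hd
  have hn2 : ‖z‖ ≤ 2 := by nlinarith
  have hn1 : 1 / 2 ≤ ‖z‖ := by nlinarith
  have habs : |z.im / ‖z‖| = |z.im| / ‖z‖ := by rw [abs_div, abs_norm]
  refine ⟨hz, div_ne_zero (abs_pos.1 hi) hn.ne', ?_, ?_⟩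
  · rw [habs, div_le_iff₀ hn]
    nlinarith
  · have hlog : Real.log (‖z‖ ^ 2) = 2 * Real.log ‖z‖ := by rw [Real.log_pow]; norm_num
    have hpos : 0 < ‖z‖ ^ 2 := by positivity
    have l1 := Real.log_le_sub_one_of_pos hpos
    have l2 := Real.one_sub_inv_le_log_of_pos hpos
    have l3 : -(8 * ε * |z.im|) ≤ 1 - (‖z‖ ^ 2)⁻¹ := by
      have : 1 - (‖z‖ ^ 2)⁻¹ = (‖z‖ ^ 2 - 1) / ‖z‖ ^ 2 := by field_simp
      rw [this, le_div_iff₀ hpos]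
      have : 0 ≤ ε * |z.im| := by positivity
      nlinarith
    have l4 : |z.im| ≤ 2 * |z.im / ‖z‖| := by
      rw [habs, ← mul_div_assoc, le_div_iff₀ hn]
      nlinarith
    calc |Real.log ‖z‖| ≤ 4 * ε * |z.im| := abs_le.2 ⟨by linarith, by linarith [mul_pos hε0 hi]⟩
      _ ≤ 4 * ε * (2 * |z.im / ‖z‖|) := by gcongr
      _ = 8 * ε * |z.im / ‖z‖| := by ring

theorem eventually_abs_log_norm_centeredCoord_le (p : Plane) {v : Plane} (hv : v ≠ 0) {ε : ℝ}
    (hε : 0 < ε) : ∀ᶠ x in dirFilter p (Projectivization.mk ℝ v hv),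
      centeredCoord p v x ≠ 0 ∧
      (centeredCoord p v x).im / ‖centeredCoord p v x‖ ≠ 0 ∧
      |(centeredCoord p v x).im / ‖centeredCoord p v x‖| ≤ ε ∧
      |Real.log ‖centeredCoord p v x‖| ≤
        ε * |(centeredCoord p v x).im / ‖centeredCoord p v x‖| := by
  have hε' : 0 < min ε 1 / 16 := by positivity
  have hle : dirFilter p (Projectivization.mk ℝ v hv) ≤ 𝓝 p := inf_le_left.trans nhdsWithin_le_nhds
  have hc : Tendsto (fun x => |coordAlong v (x - p)|) (𝓝 p) (𝓝 0) := by
    have := continuous_coordAlong v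
    have hc : Continuous fun x => |coordAlong v (x - p)| := by fun_prop
    simpa [coordAlong] using hc.tendsto p
  filter_upwards [eventually_coordAlong_lt p hv hε', hle (hc (Iio_mem_nhds hε'))] with x h1 h2
  have h16 : min ε 1 / 16 ≤ 1 / 16 := by linarith [min_le_right ε 1]
  have hmin := min_le_left ε 1
  obtain ⟨a, b, c, d⟩ := abs_log_norm_le (z := centeredCoord p v x) h16
    (by simpa [centeredCoord] using h1) h2
  refine ⟨a, b, c.trans (by linarith), d.trans ?_⟩
  gcongr
  linarith

/-- Given sets accumulating at `p` along `l`, some simple closed `C¹` curve through `p` meets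
each of them in points converging to `p`. -/
theorem exists_isC1Curve_through (p : Plane) (l : ProjLine) {S : ℕ → Set Plane}
    (hS : ∀ k, ∃ᶠ x in dirFilter p l, x ∈ S k) :
    ∃ Γ, IsC1Curve Γ ∧ p ∈ Γ ∧ ∃ z : ℕ → Plane,
      (∀ k, z k ∈ S k ∧ z k ∈ Γ ∧ z k ≠ p) ∧ Tendsto z atTop (𝓝 p) := by
  induction l using Projectivization.ind with
  | h v hv =>
  let s : Plane → ℝ := fun x => (centeredCoord p v x).im / ‖centeredCoord p v x‖
  let r : Plane → ℝ := fun x => Real.log ‖centeredCoord p v x‖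
  have key : ∀ (k : ℕ) (ε : ℝ), ∃ x, 0 < ε → x ∈ S k ∧ x ≠ p ∧ dist x p ≤ ε ∧
      centeredCoord p v x ≠ 0 ∧ s x ≠ 0 ∧ |s x| ≤ ε ∧ |r x| ≤ (1 / 2) ^ k * |s x| := by
    intro k ε
    by_cases hε : 0 < ε
    swap
    · exact ⟨p, fun h => absurd h hε⟩
    have hε' : 0 < min ε ((1 / 2) ^ k) := by positivity
    have hne : ∀ᶠ x in dirFilter p (Projectivization.mk ℝ v hv), x ≠ p :=
      inf_le_left (a := 𝓝[≠] p) self_mem_nhdsWithin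
    have hdist : ∀ᶠ x in dirFilter p (Projectivization.mk ℝ v hv), dist x p ≤ ε :=
      (inf_le_left.trans nhdsWithin_le_nhds : _ ≤ 𝓝 p) (Metric.closedBall_mem_nhds p hε)
    obtain ⟨x, hxS, hxp, hxd, h1, h2, h3, h4⟩ := ((hS k).and_eventually (hne.and (hdist.and
      (eventually_abs_log_norm_centeredCoord_le p hv hε')))).exists
    refine ⟨x, fun _ => ⟨hxS, hxp, hxd, h1, h2, h3.trans (min_le_left _ _), h4.trans ?_⟩⟩
    gcongr
    exact min_le_right _ _
  choose Z hZ using key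
  let z : ℕ → Plane := fun n => Nat.rec (Z 0 1)
    (fun k x => Z (k + 1) (min (|s x| / 2) ((1 / 2) ^ (k + 1)))) n
  have hz_succ : ∀ k, z (k + 1) = Z (k + 1) (min (|s (z k)| / 2) ((1 / 2) ^ (k + 1))) :=
    fun k => rfl
  have hs0 : ∀ k, s (z k) ≠ 0 := by
    intro k
    induction k with
    | zero => exact (hZ 0 1 one_pos).2.2.2.2.1
    | succ k ih => exact (hZ (k + 1) (min (|s (z k)| / 2) ((1 / 2) ^ (k + 1)))
        (by have := abs_pos.2 ih; positivity)).2.2.2.2.1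
  have hε : ∀ k, 0 < min (|s (z k)| / 2) ((1 / 2 : ℝ) ^ (k + 1)) := fun k => by
    have := abs_pos.2 (hs0 k)
    positivity
  have hz : ∀ k, z k ∈ S k ∧ z k ≠ p ∧ dist (z k) p ≤ (1 / 2) ^ k ∧ centeredCoord p v (z k) ≠ 0 ∧
      |r (z k)| ≤ (1 / 2) ^ k * |s (z k)| := by
    rintro (_ | k)
    · obtain ⟨h1, h2, h3, h4, -, -, h7⟩ := hZ 0 1 one_pos
      exact ⟨h1, h2, by rwa [pow_zero], h4, h7⟩
    · obtain ⟨h1, h2, h3, h4, -, -, h7⟩ := hZ (k + 1) _ (hε k)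
      exact ⟨h1, h2, h3.trans (min_le_right _ _), h4, h7⟩
  obtain ⟨h, hh, hh0, hhs⟩ := exists_contDiff_interpolation (s := s ∘ z) (r := r ∘ z) hs0
    (fun k => (hZ (k + 1) _ (hε k)).2.2.2.2.2.1.trans (min_le_left _ _)) fun k => (hz k).2.2.2.2
  refine ⟨_, ⟨polarLoop p v h, isRegParam_polarLoop p hv hh, rfl⟩, ⟨0, by simp [polarLoop, hh0]⟩,
    z, fun k => ⟨(hz k).1, mem_range_polarLoop hv (hz k).2.2.2.1 (hhs k), (hz k).2.1⟩, ?_⟩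
  rw [tendsto_iff_dist_tendsto_zero]
  exact squeeze_zero (fun _ => dist_nonneg) (fun k => (hz k).2.2.1)
    (tendsto_pow_atTop_nhds_zero_of_lt_one (by norm_num) (by norm_num))

/-! ### The induced map on tangent lines -/

section Induced

variable {f : Plane ≃ₜ Plane} {p : Plane}

theorem tendsto_secantDir_of_mem {Γ : Set Plane} {m : ProjLine}
    (h : TangentAt (f '' Γ) (f p) m) :
    Tendsto (fun x => secantDir (f p) (f x)) (𝓝[Γ \ {p}] p) (𝓝 m) := by
  refine (tendsto_secantDir_dirFilter (f p) m).comp (Tendsto.mono_right ?_ h.nhdsWithin_le)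
  refine tendsto_nhdsWithin_iff.2
    ⟨f.continuous.continuousAt.tendsto.mono_left nhdsWithin_le_nhds, ?_⟩
  filter_upwards [self_mem_nhdsWithin] with x hx
  exact ⟨Set.mem_image_of_mem f hx.1, fun e => hx.2 (f.injective e)⟩

theorem MapsC1.exists_tendsto_secantDir (hf : MapsC1 f) (p : Plane) (l : ProjLine) :
    ∃ m, Tendsto (fun x => secantDir (f p) (f x)) (dirFilter p l) (𝓝 m) := by
  obtain ⟨Γ₀, hΓ₀⟩ := exists_tangentAt p l
  obtain ⟨m, hm⟩ := (hf Γ₀ hΓ₀.isC1Curve).exists_tangentAt (Set.mem_image_of_mem f hΓ₀.mem)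
  refine ⟨m, ?_⟩
  by_contra hcon
  rw [Filter.not_tendsto_iff_exists_frequently_notMem] at hcon
  obtain ⟨U, hU, hfreq⟩ := hcon
  have hfreq₀ : ∃ᶠ x in dirFilter p l, x ∈ Γ₀ \ {p} :=
    have := hΓ₀.nhdsWithin_neBot
    (Eventually.frequently (f := 𝓝[Γ₀ \ {p}] p) self_mem_nhdsWithin).filter_mono
      hΓ₀.nhdsWithin_le
  let S : ℕ → Set Plane := fun k => if Even k then Γ₀ \ {p} else {x | secantDir (f p) (f x) ∉ U}
  obtain ⟨Γ, hΓ, hpΓ, z, hz, hzp⟩ := exists_isC1Curve_through p l (S := S) fun k => by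
    by_cases hk : Even k
    · simpa only [S, if_pos hk] using hfreq₀
    · simp only [S, if_neg hk]
      exact hfreq
  obtain ⟨m', hm'⟩ := (hf Γ hΓ).exists_tangentAt (Set.mem_image_of_mem f hpΓ)
  have hzΓ : Tendsto (fun k => secantDir (f p) (f (z k))) atTop (𝓝 m') :=
    (tendsto_secantDir_of_mem hm').comp (tendsto_nhdsWithin_iff.2
      ⟨hzp, Eventually.of_forall fun k => ⟨(hz k).2.1, (hz k).2.2⟩⟩)
  have heven : Tendsto (fun k : ℕ => 2 * k) atTop atTop :=
    tendsto_id.const_mul_atTop' two_pos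
  have hodd : Tendsto (fun k : ℕ => 2 * k + 1) atTop atTop :=
    (tendsto_add_atTop_nat 1).comp heven
  have hzΓ₀ : Tendsto (fun k => secantDir (f p) (f (z (2 * k)))) atTop (𝓝 m) := by
    refine (tendsto_secantDir_of_mem hm).comp (tendsto_nhdsWithin_iff.2
      ⟨hzp.comp heven, Eventually.of_forall fun k => ?_⟩)
    have := (hz (2 * k)).1
    rwa [show S (2 * k) = Γ₀ \ {p} from if_pos (even_two_mul k)] at this
  obtain rfl : m' = m := tendsto_nhds_unique (hzΓ.comp heven) hzΓ₀
  obtain ⟨k, hk⟩ := ((hzΓ.comp hodd).eventually hU).exists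
  have := (hz (2 * k + 1)).1
  rw [show S (2 * k + 1) = {x | secantDir (f p) (f x) ∉ U} from
    if_neg (Nat.not_even_two_mul_add_one k)] at this
  exact this hk

theorem MapsC1.exists_continuous_tangentMap (hf : MapsC1 f) (p : Plane) :
    ∃ φ : ProjLine → ProjLine, Continuous φ ∧
      ∀ Γ l, TangentAt Γ p l → TangentAt (f '' Γ) (f p) (φ l) := by
  choose φ hφ using hf.exists_tendsto_secantDir p
  refine ⟨φ, ?_, fun Γ l h => ?_⟩
  · rw [continuous_iff_continuousAt]
    intro l
    refine (closed_nhds_basis (φ l)).tendsto_right_iff.2 fun W hW => ?_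
    obtain ⟨A, hA, B, hB, hAB⟩ := mem_inf_iff_superset.1 (hφ l hW.1)
    obtain ⟨V, hV, hVB⟩ := mem_comap.1 hB
    filter_upwards [eventually_mem_nhds_iff.2 hV] with l' hl'
    refine hW.2.mem_of_tendsto (hφ l') ?_
    exact mem_inf_iff_superset.2 ⟨A, hA, _, preimage_mem_comap hl',
      fun x hx => hAB ⟨hx.1, hVB hx.2⟩⟩
  · obtain ⟨m, hm⟩ := (hf Γ h.isC1Curve).exists_tangentAt (Set.mem_image_of_mem f h.mem)
    have := h.nhdsWithin_neBot
    rwa [← tendsto_nhds_unique (tendsto_secantDir_of_mem hm) ((hφ l).mono_left h.nhdsWithin_le)]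

end Induced

theorem TangentAt.unique {Γ : Set Plane} {p : Plane} {l m : ProjLine} (hl : TangentAt Γ p l)
    (hm : TangentAt Γ p m) : l = m :=
  have := hl.nhdsWithin_neBot
  tendsto_nhds_unique ((tendsto_secantDir_dirFilter p l).mono_left hl.nhdsWithin_le)
    ((tendsto_secantDir_dirFilter p m).mono_left hm.nhdsWithin_le)

/-- Maps induced by mutually inverse homeomorphisms are mutually inverse. -/
theorem leftInverse_of_tangentAt {f g : Plane → Plane} (hgf : Function.LeftInverse g f) {p : Plane}
    {φ ψ : ProjLine → ProjLine}
    (hφ : ∀ Γ l, TangentAt Γ p l → TangentAt (f '' Γ) (f p) (φ l))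
    (hψ : ∀ Γ l, TangentAt Γ (f p) l → TangentAt (g '' Γ) (g (f p)) (ψ l)) :
    Function.LeftInverse ψ φ := by
  intro l
  obtain ⟨Γ, hΓ⟩ := exists_tangentAt p l
  have h := hψ _ _ (hφ Γ l hΓ)
  rw [hgf.image_image, hgf] at h
  exact h.unique hΓ

/-- Every `f ∈ Homeo¹(ℝ²)` induces, at each point `p`, a homeomorphism of the
projective tangent space compatible with tangent lines of C¹ curves through `p`. -/
theorem induced_homeo_exists (f : Plane ≃ₜ Plane) (hf : InHomeo1 f) (p : Plane) :
    ∃ φ : ProjLine ≃ₜ ProjLine, InducesAt ⇑f p φ := by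
  obtain ⟨φ, hφc, hφ⟩ := hf.1.exists_continuous_tangentMap p
  obtain ⟨ψ, hψc, hψ⟩ := hf.2.exists_continuous_tangentMap (f p)
  refine ⟨⟨⟨φ, ψ, leftInverse_of_tangentAt f.symm_apply_apply hφ hψ,
    leftInverse_of_tangentAt f.apply_symm_apply hψ ?_⟩, hφc, hψc⟩,
    fun Γ l h => ⟨hf.1 Γ h.isC1Curve, hφ Γ l h⟩⟩
  rw [f.symm_apply_apply]
  exact hφ
end
end

section
/- Let p ∈ ℝ², let ℓ ∈ ℙ(ℝ²), and let (pₙ) be a sequence in ℝ² \ {p} that converges along ℓ to p. Let (ℓₙ) be a sequence in ℙ(ℝ²) such that (pₙ, ℓₙ) → (p, ℓ) in ℝ² × ℙ(ℝ²). Then there exist a strictly increasing sequence of indices (n_k) and a simple closed C¹ curve Γ in ℝ² such that for all k, p_{n_k} ∈ Γ and the tangent line of Γ at p_{n_k} is ℓ_{n_k}. -/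
open Filter Topology

noncomputable section

theorem contDiffBump_half_eq_zero {f : ContDiffBump (0 : ℝ)} (hf : f.rOut = 1 / 2) {y : ℝ}
    (hy : 1 / 2 < |y|) : f y = 0 ∧ deriv f y = 0 := by
  have hev : (f : ℝ → ℝ) =ᶠ[𝓝 y] fun _ => 0 := by
    filter_upwards [(isOpen_lt continuous_const continuous_abs).mem_nhds hy] with z hz
    apply f.zero_of_le_dist
    rw [hf, Real.dist_eq, sub_zero]
    exact le_of_lt hz
  exact ⟨hev.eq_of_nhds, by simpa using hev.deriv_eq⟩

/-- Interpolation of first-order data by a `C¹` function along a lacunary sequence. -/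
theorem exists_contDiff_interpolation_s7 (a β m : ℕ → ℝ) (ha : ∀ k, a k ≠ 0)
    (hlac : ∀ j k, j < k → |a k| ≤ |a j| / 4) (hβ : ∀ k, |β k| ≤ (1 / 2) ^ k)
    (hm : ∀ k, |m k| ≤ (1 / 2) ^ k) :
    ∃ G : ℝ → ℝ, ContDiff ℝ 1 G ∧ ∀ k, G (a k) = a k * β k ∧ deriv G (a k) = m k := by
  let f : ContDiffBump (0 : ℝ) := ⟨1 / 4, 1 / 2, by norm_num, by norm_num⟩
  have hf : ContDiff ℝ 1 f := f.contDiff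
  have hd : ∀ y, HasDerivAt f (deriv f y) y := fun y =>
    (hf.differentiable one_ne_zero y).hasDerivAt
  have hf' : Continuous (deriv f) := hf.continuous_deriv le_rfl
  have hzero : ∀ {y : ℝ}, 1 / 2 < |y| → f y = 0 ∧ deriv f y = 0 :=
    contDiffBump_half_eq_zero rfl
  have h1 : f 0 = 1 := f.one_of_mem_closedBall (by simp [f])
  have h1' : deriv f 0 = 0 := by
    have : (f : ℝ → ℝ) =ᶠ[𝓝 0] fun _ => 1 := f.eventuallyEq_one
    simpa using this.deriv_eq
  let y : ℕ → ℝ → ℝ := fun k s => (s - a k) / a k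
  let h : ℕ → ℝ → ℝ := fun k s => a k * (β k * f (y k s) + m k * (y k s * f (y k s)))
  let h' : ℕ → ℝ → ℝ := fun k s =>
    β k * deriv f (y k s) + m k * (f (y k s) + y k s * deriv f (y k s))
  have hy : ∀ k s, HasDerivAt (y k) (1 / a k) s := fun k s =>
    ((hasDerivAt_id s).sub_const (a k)).div_const (a k)
  have hh : ∀ k s, HasDerivAt (h k) (h' k s) s := by
    intro k s
    have e := (hd (y k s)).comp s (hy k s)
    refine (((e.const_mul (β k)).add (((hy k s).mul e).const_mul (m k))).const_mul
      (a k)).congr_deriv ?_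
    simp only [h', Function.comp]
    field_simp [ha k]
  have hh'c : ∀ k, Continuous (h' k) := by
    intro k
    have : Continuous (y k) := by fun_prop
    have := f.continuous
    fun_prop
  obtain ⟨C, hC⟩ : ∃ C, ∀ z, |deriv f z| ≤ C := by
    obtain ⟨C, hC⟩ := f.hasCompactSupport.deriv.exists_bound_of_continuous hf'
    exact ⟨C, hC⟩
  have hC0 : 0 ≤ C := (abs_nonneg _).trans (hC 0)
  have hbound : ∀ k s, ‖h' k s‖ ≤ (2 * C + 1) * (1 / 2) ^ k := by
    intro k s
    have hfl : |f (y k s)| ≤ 1 := by rw [abs_of_nonneg f.nonneg]; exact f.le_one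
    have hyf : |y k s * deriv f (y k s)| ≤ C := by
      rcases lt_or_ge (1 / 2) |y k s| with hlt | hge
      · simp [(hzero hlt).2, hC0]
      · rw [abs_mul]
        nlinarith [hC (y k s), abs_nonneg (y k s), abs_nonneg (deriv f (y k s))]
    calc ‖h' k s‖ ≤ |β k * deriv f (y k s)| + |m k * (f (y k s) + y k s * deriv f (y k s))| :=
          abs_add_le _ _
      _ = |β k| * |deriv f (y k s)| + |m k| * |f (y k s) + y k s * deriv f (y k s)| := by
          rw [abs_mul, abs_mul]
      _ ≤ (1 / 2) ^ k * C + (1 / 2) ^ k * (1 + C) := by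
          gcongr
          · exact hβ k
          · exact hC _
          · exact hm k
          · exact (abs_add_le _ _).trans (add_le_add hfl hyf)
      _ = _ := by ring
  have hsum : Summable fun k : ℕ => (2 * C + 1) * (1 / 2 : ℝ) ^ k :=
    summable_geometric_two.mul_left _
  have hs0 : Summable fun k => h k 0 := by
    have : (fun k => h k 0) = fun _ => 0 := by
      funext k
      have hk : y k 0 = -1 := by simp [y, ha k]
      have : f (-1) = 0 := (hzero (by norm_num)).1
      simp [h, hk, this]
    rw [this]
    exact summable_zero
  have hG : ∀ s, HasDerivAt (fun z => ∑' k, h k z) (∑' k, h' k s) s :=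
    hasDerivAt_tsum hsum hh hbound hs0
  have hoff : ∀ j k, j ≠ k → 1 / 2 < |y j (a k)| := by
    intro j k hjk
    have haj := abs_pos.mpr (ha j)
    have hak := abs_pos.mpr (ha k)
    simp only [y]
    rw [abs_div, lt_div_iff₀ haj]
    rcases lt_or_gt_of_ne hjk with hlt | hlt
    · have := hlac _ _ hlt
      have := abs_sub_abs_le_abs_sub (a j) (a k)
      rw [abs_sub_comm]
      linarith
    · have := hlac _ _ hlt
      have := abs_sub_abs_le_abs_sub (a k) (a j)
      linarith
  have hon : ∀ k, y k (a k) = 0 := by simp [y]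
  refine ⟨fun s => ∑' k, h k s, ?_, fun k => ⟨?_, ?_⟩⟩
  · rw [contDiff_one_iff_deriv]
    refine ⟨fun s => (hG s).differentiableAt, ?_⟩
    rw [funext fun s => (hG s).deriv]
    exact continuous_tsum hh'c hsum hbound
  · dsimp only
    rw [tsum_eq_single k]
    · simp [h, hon, h1]
    · intro j hj
      simp [h, (hzero (hoff j k hj)).1]
  · rw [(hG _).deriv, tsum_eq_single k]
    · simp [h', hon, h1, h1']
    · intro j hj
      simp [h', (hzero (hoff j k hj)).1, (hzero (hoff j k hj)).2]

theorem exists_lacunary_subsequence {a : ℕ → ℝ} (ha : Tendsto a atTop (𝓝 0))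
    (ha0 : ∀ᶠ n in atTop, a n ≠ 0) :
    ∃ φ : ℕ → ℕ, StrictMono φ ∧ (∀ k, a (φ k) ≠ 0) ∧
      ∀ j k, j < k → |a (φ k)| ≤ |a (φ j)| / 4 := by
  obtain ⟨φ, h0, hφ⟩ := exists_seq_of_forall_finset_exists (fun n => a n ≠ 0)
    (fun m n => m < n ∧ |a n| ≤ |a m| / 4) (by
      intro s hs
      have hall : ∀ᶠ n in atTop, ∀ i ∈ s, i < n ∧ |a n| ≤ |a i| / 4 := by
        rw [eventually_all_finset]
        intro i hi
        have hpos : 0 < |a i| / 4 := by have := abs_pos.mpr (hs i hi); positivity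
        have habs : Tendsto (fun n => |a n|) atTop (𝓝 0) := by simpa using ha.abs
        exact (eventually_gt_atTop i).and (habs.eventually_le_const hpos)
      exact (ha0.and hall).exists)
  exact ⟨φ, fun i j hij => (hφ i j hij).1, h0, fun j k hjk => (hφ j k hjk).2⟩

/-- The image of a circle under the shear `(x, y) ↦ (x, y + G x)`, put in affine position. -/
def shearedCircle (p v : Plane) (G : ℝ → ℝ) (t : ℝ) : Plane :=
  p + Real.sin (2 * Real.pi * t) • v +
    (1 - Real.cos (2 * Real.pi * t) + G (Real.sin (2 * Real.pi * t))) • ((-v.2, v.1) : Plane)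

theorem hasDerivAt_shearedCircle (p v : Plane) {G : ℝ → ℝ} (hG : ContDiff ℝ 1 G) (t : ℝ) :
    HasDerivAt (shearedCircle p v G)
      ((2 * Real.pi * Real.cos (2 * Real.pi * t)) • v +
        (2 * Real.pi * (Real.sin (2 * Real.pi * t) + deriv G (Real.sin (2 * Real.pi * t)) *
          Real.cos (2 * Real.pi * t))) • ((-v.2, v.1) : Plane)) t := by
  have hl : HasDerivAt (fun t : ℝ => 2 * Real.pi * t) (2 * Real.pi) t := by
    simpa using (hasDerivAt_id t).const_mul (2 * Real.pi)
  have hs := hl.sin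
  have hg := ((hG.differentiable one_ne_zero _).hasDerivAt).comp t hs
  refine (((hs.smul_const v).const_add p).add
    (((hl.cos.const_sub 1).add hg).smul_const ((-v.2, v.1) : Plane))).congr_deriv ?_
  congr 2 <;> ring

theorem sq_add_sq_ne_zero {v : Plane} (hv : v ≠ 0) : v.1 ^ 2 + v.2 ^ 2 ≠ 0 := by
  intro h0
  exact hv (Prod.ext (by simp; nlinarith [sq_nonneg v.1, sq_nonneg v.2])
    (by simp; nlinarith [sq_nonneg v.1, sq_nonneg v.2]))

theorem linear_combination_rotate_eq {v : Plane} (hv : v ≠ 0) {s y s' y' : ℝ}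
    (h : s • v + y • ((-v.2, v.1) : Plane) = s' • v + y' • ((-v.2, v.1) : Plane)) :
    s = s' ∧ y = y' := by
  have hN := sq_add_sq_ne_zero hv
  have e1 := congrArg Prod.fst h
  have e2 := congrArg Prod.snd h
  simp at e1 e2
  constructor <;> apply mul_right_cancel₀ hN
  · linear_combination v.1 * e1 + v.2 * e2
  · linear_combination v.1 * e2 - v.2 * e1

theorem isRegParam_shearedCircle (p : Plane) {v : Plane} (hv : v ≠ 0) {G : ℝ → ℝ}
    (hG : ContDiff ℝ 1 G) : IsRegParam (shearedCircle p v G) := by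
  refine ⟨?_, ?_, ?_, ?_⟩
  · unfold shearedCircle
    fun_prop
  · intro t
    simp [shearedCircle, mul_add, Real.sin_add_two_pi, Real.cos_add_two_pi]
  · intro s hs t ht hst
    simp only [shearedCircle, add_assoc] at hst
    obtain ⟨h1, h2⟩ := linear_combination_rotate_eq hv (add_left_cancel hst)
    have h3 : Real.cos (2 * Real.pi * s) = Real.cos (2 * Real.pi * t) := by
      rw [h1] at h2
      linarith
    have h4 : ((2 * Real.pi * s : ℝ) : Real.Angle) = ((2 * Real.pi * t : ℝ) : Real.Angle) :=
      Real.Angle.cos_sin_inj h3 h1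
    obtain ⟨k, hk⟩ := Real.Angle.angle_eq_iff_two_pi_dvd_sub.mp h4
    have hk' : s - t = k := by
      apply mul_left_cancel₀ (mul_pos two_pos Real.pi_pos).ne'
      linear_combination hk
    have hk1 : (k : ℝ) < 1 := by linarith [hs.2, ht.1]
    have hk2 : (-1 : ℝ) < k := by linarith [hs.1, ht.2]
    have hk0 : k = 0 := by
      have h5 : k < 1 := by exact_mod_cast hk1
      have h6 : -1 < k := by exact_mod_cast hk2
      omega
    rw [hk0, Int.cast_zero] at hk'
    linarith
  · intro t h0
    rw [(hasDerivAt_shearedCircle p v hG t).deriv] at h0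
    obtain ⟨h1, h2⟩ := linear_combination_rotate_eq hv (s' := 0) (y' := 0)
      (h0.trans (by simp))
    have hpi : 2 * Real.pi ≠ 0 := (mul_pos two_pos Real.pi_pos).ne'
    have hc := (mul_eq_zero.mp h1).resolve_left hpi
    have hs := (mul_eq_zero.mp h2).resolve_left hpi
    rw [hc, mul_zero, add_zero] at hs
    have := Real.sin_sq_add_cos_sq (2 * Real.pi * t)
    rw [hs, hc] at this
    norm_num at this

/-- The unnormalized coordinates of a vector in the frame `v, (-v.2, v.1)`. -/
def alongCoord (v u : Plane) : ℝ := v.1 * u.1 + v.2 * u.2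

def acrossCoord (v u : Plane) : ℝ := v.1 * u.2 - v.2 * u.1

theorem slope_rep_mk (v u : Plane) (hu : u ≠ 0) :
    ∃ c : ℝ, c ≠ 0 ∧ alongCoord v (Projectivization.mk ℝ u hu).rep = c * alongCoord v u ∧
      acrossCoord v (Projectivization.mk ℝ u hu).rep = c * acrossCoord v u := by
  obtain ⟨c, hc⟩ := Projectivization.exists_smul_eq_mk_rep ℝ u hu
  refine ⟨c, c.ne_zero, ?_, ?_⟩
  · rw [← hc]; simp [alongCoord, Units.smul_def]; ring
  · rw [← hc]; simp [acrossCoord, Units.smul_def]; ring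

theorem eventually_abs_acrossCoord_lt {ι : Type*} {F : Filter ι} {K : ι → ProjLine} {v : Plane}
    (hv : v ≠ 0) (hK : Tendsto K F (𝓝 (Projectivization.mk ℝ v hv))) {ε : ℝ} (hε : 0 < ε) :
    ∀ᶠ i in F, |acrossCoord v (K i).rep| < ε * |alongCoord v (K i).rep| := by
  have hinv : ∀ u (hu : u ≠ 0),
      |acrossCoord v (Projectivization.mk ℝ u hu).rep| <
        ε * |alongCoord v (Projectivization.mk ℝ u hu).rep| ↔
      |acrossCoord v u| < ε * |alongCoord v u| := by
    intro u hu
    obtain ⟨c, hc, e2, e1⟩ := slope_rep_mk v u hu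
    have hc0 : 0 < |c| := abs_pos.mpr hc
    rw [e1, e2, abs_mul, abs_mul, mul_left_comm, mul_lt_mul_iff_right₀ hc0]
  have hopen : IsOpen {M : ProjLine | |acrossCoord v M.rep| < ε * |alongCoord v M.rep|} := by
    refine isQuotientMap_quotient_mk'.isOpen_preimage.mp ?_
    have hpre : IsOpen {u : {u : Plane // u ≠ 0} | |acrossCoord v u.1| < ε * |alongCoord v u.1|} := by
      unfold acrossCoord alongCoord
      exact isOpen_lt (by fun_prop) (by fun_prop)
    convert hpre using 1
    ext u
    exact hinv u.1 u.2
  refine hK.eventually (hopen.mem_nhds ?_)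
  rw [Set.mem_ofPred_eq, hinv]
  have hne : alongCoord v v ≠ 0 := by
    simpa [alongCoord, sq] using sq_add_sq_ne_zero hv
  have hz : acrossCoord v v = 0 := by simp [acrossCoord, mul_comm]
  rw [hz, abs_zero]
  exact mul_pos hε (abs_pos.mpr hne)

theorem tendsto_slope_rep {ι : Type*} {F : Filter ι} {K : ι → ProjLine} {v : Plane}
    (hv : v ≠ 0) (hK : Tendsto K F (𝓝 (Projectivization.mk ℝ v hv))) :
    (∀ᶠ i in F, alongCoord v (K i).rep ≠ 0) ∧
      Tendsto (fun i => acrossCoord v (K i).rep / alongCoord v (K i).rep) F (𝓝 0) := by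
  have hne : ∀ {ε : ℝ} {i}, |acrossCoord v (K i).rep| < ε * |alongCoord v (K i).rep| →
      alongCoord v (K i).rep ≠ 0 := by
    intro ε i hi h0
    rw [h0, abs_zero, mul_zero] at hi
    exact absurd hi (abs_nonneg _).not_gt
  refine ⟨(eventually_abs_acrossCoord_lt hv hK one_pos).mono fun i hi => hne hi, ?_⟩
  rw [Metric.tendsto_nhds]
  intro ε hε
  filter_upwards [eventually_abs_acrossCoord_lt hv hK hε] with i hi
  rwa [Real.dist_eq, sub_zero, abs_div, div_lt_iff₀ (abs_pos.mpr (hne hi))]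

theorem abs_one_sub_cos_arcsin_div_le {a : ℝ} (ha : |a| < 1) :
    |(1 - Real.cos (Real.arcsin a)) / a| ≤ |a| := by
  rcases eq_or_ne a 0 with rfl | h0
  · simp
  have hsq : a ^ 2 < 1 := (sq_lt_one_iff_abs_lt_one a).mpr ha
  rw [Real.cos_arcsin, abs_div, div_le_iff₀ (abs_pos.mpr h0), abs_mul_abs_self]
  have h1 : √(1 - a ^ 2) ^ 2 = 1 - a ^ 2 := Real.sq_sqrt (by linarith)
  have h2 := Real.sqrt_nonneg (1 - a ^ 2)
  rw [abs_of_nonneg] <;> nlinarith [sq_nonneg a]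

/-- If `x` converges along `ℓ` to `p` and the pairs `(x n, L n)` converge to
`(p, ℓ)`, then some subsequence of the points lies on a single simple closed C¹ curve
with the prescribed tangent lines. -/
theorem c1_curve_through_tangents (p : Plane) (ℓ : ProjLine) (x : ℕ → Plane)
    (hconv : ConvAlong p ℓ x) (L : ℕ → ProjLine)
    (hL : Tendsto (fun n => (x n, L n)) atTop (𝓝 (p, ℓ))) :
    ∃ (φ : ℕ → ℕ) (Γ : Set Plane), StrictMono φ ∧ IsC1Curve Γ ∧
      ∀ k : ℕ, x (φ k) ∈ Γ ∧ TangentAt Γ (x (φ k)) (L (φ k)) := by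
  have hx := hconv.2.1
  have hLl : Tendsto L atTop (𝓝 ℓ) := (continuous_snd.tendsto _).comp hL
  obtain ⟨v, hv, rfl⟩ : ∃ v, ∃ hv : v ≠ 0, ℓ = Projectivization.mk ℝ v hv :=
    ⟨ℓ.rep, ℓ.rep_nonzero, ℓ.mk_rep.symm⟩
  set N : ℝ := v.1 ^ 2 + v.2 ^ 2 with hNdef
  have hN : N ≠ 0 := sq_add_sq_ne_zero hv
  have hframe : ∀ u : Plane, u = (alongCoord v u / N) • v +
      (acrossCoord v u / N) • ((-v.2, v.1) : Plane) := by
    intro u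
    ext <;> simp [alongCoord, acrossCoord] <;> field_simp <;> rw [hNdef] <;> ring
  obtain ⟨hLne, hLslope⟩ := tendsto_slope_rep hv hLl
  obtain ⟨hSne, hSslope⟩ := tendsto_slope_rep hv hconv.2.2
  have hsec : ∀ n, ∃ c : ℝ, c ≠ 0 ∧
      alongCoord v (secantDir p (x n)).rep = c * alongCoord v (x n - p) ∧
      acrossCoord v (secantDir p (x n)).rep = c * acrossCoord v (x n - p) := by
    intro n
    rw [secantDir, dif_neg (hconv.1 n)]
    exact slope_rep_mk _ _ _
  let a : ℕ → ℝ := fun n => alongCoord v (x n - p) / N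
  let b : ℕ → ℝ := fun n => acrossCoord v (x n - p) / N
  let m : ℕ → ℝ := fun n => acrossCoord v (L n).rep / alongCoord v (L n).rep
  have ha0 : ∀ᶠ n in atTop, a n ≠ 0 := by
    filter_upwards [hSne] with n hn
    obtain ⟨c, -, h1, -⟩ := hsec n
    rw [h1] at hn
    exact div_ne_zero (right_ne_zero_of_mul hn) hN
  have hba : Tendsto (fun n => b n / a n) atTop (𝓝 0) := by
    refine hSslope.congr fun n => ?_
    obtain ⟨c, hc, h1, h2⟩ := hsec n
    rw [h1, h2, mul_div_mul_left _ _ hc]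
    exact (div_div_div_cancel_right₀ hN _ _).symm
  have ha : Tendsto a atTop (𝓝 0) := by
    have hcont : Continuous fun u : Plane => alongCoord v (u - p) / N := by
      unfold alongCoord
      fun_prop
    exact (hcont.tendsto' p 0 (by simp [alongCoord])).comp hx
  have ha1 : ∀ᶠ n in atTop, |a n| < 1 := by
    have habs : Tendsto (fun n => |a n|) atTop (𝓝 0) := by simpa using ha.abs
    exact habs.eventually_lt_const one_pos
  let β : ℕ → ℝ := fun n => b n / a n - (1 - Real.cos (Real.arcsin (a n))) / a n
  let μ : ℕ → ℝ := fun n => m n - Real.tan (Real.arcsin (a n))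
  have hβ : Tendsto β atTop (𝓝 0) := by
    have hq : Tendsto (fun n => (1 - Real.cos (Real.arcsin (a n))) / a n) atTop (𝓝 0) := by
      refine squeeze_zero_norm' (a := fun n => |a n|) ?_ (by simpa using ha.abs)
      filter_upwards [ha1] with n hn using abs_one_sub_cos_arcsin_div_le hn
    simpa using hba.sub hq
  have hμ : Tendsto μ atTop (𝓝 0) := by
    have ht : ContinuousAt (fun s => Real.tan (Real.arcsin s)) 0 := by
      refine ContinuousAt.comp (g := Real.tan) ?_ Real.continuous_arcsin.continuousAt
      rw [Real.continuousAt_tan]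
      simp
    have := ht.tendsto.comp ha
    simp only [Real.arcsin_zero, Real.tan_zero] at this
    simpa using hLslope.sub this
  obtain ⟨φ₁, hφ₁, ha0', hlac⟩ := exists_lacunary_subsequence ha ha0
  have hev : ∀ k : ℕ, ∀ᶠ n in atTop, |β (φ₁ n)| ≤ (1 / 2) ^ k ∧ |μ (φ₁ n)| ≤ (1 / 2) ^ k ∧
      |a (φ₁ n)| < 1 ∧ alongCoord v (L (φ₁ n)).rep ≠ 0 := by
    intro k
    have hpos : (0 : ℝ) < (1 / 2) ^ k := by positivity
    have hβ' : Tendsto (fun n => |β n|) atTop (𝓝 0) := by simpa using hβ.abs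
    have hμ' : Tendsto (fun n => |μ n|) atTop (𝓝 0) := by simpa using hμ.abs
    exact hφ₁.tendsto_atTop.eventually ((hβ'.eventually_le_const hpos).and
      ((hμ'.eventually_le_const hpos).and (ha1.and hLne)))
  obtain ⟨φ₂, hφ₂, hgood⟩ := extraction_forall_of_eventually hev
  obtain ⟨G, hG, hGval⟩ := exists_contDiff_interpolation_s7
    (fun k => a (φ₁ (φ₂ k))) (fun k => β (φ₁ (φ₂ k))) (fun k => μ (φ₁ (φ₂ k)))
    (fun k => ha0' _) (fun j k hjk => hlac _ _ (hφ₂ hjk))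
    (fun k => (hgood k).1) (fun k => (hgood k).2.1)
  have hreg := isRegParam_shearedCircle p hv hG
  refine ⟨φ₁ ∘ φ₂, Set.range (shearedCircle p v G), hφ₁.comp hφ₂, ⟨_, hreg, rfl⟩, fun k => ?_⟩
  obtain ⟨-, -, hak1, hLk⟩ := hgood k
  obtain ⟨hGk, hGk'⟩ := hGval k
  have hak0 := ha0' (φ₂ k)
  rw [Function.comp_apply]
  set n := φ₁ (φ₂ k)
  set θ := Real.arcsin (a n) with hθ
  have hsin : Real.sin θ = a n := Real.sin_arcsin (abs_lt.mp hak1).1.le (abs_lt.mp hak1).2.le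
  have hcos : Real.cos θ ≠ 0 := by
    have : 0 < 1 - a n ^ 2 := by
      have := (sq_lt_one_iff_abs_lt_one (a n)).mpr hak1
      linarith
    rw [hθ, Real.cos_arcsin]
    exact (Real.sqrt_pos.mpr this).ne'
  have hpi : 2 * Real.pi ≠ 0 := (mul_pos two_pos Real.pi_pos).ne'
  have harg : 2 * Real.pi * (θ / (2 * Real.pi)) = θ := mul_div_cancel₀ _ hpi
  have hpt : shearedCircle p v G (θ / (2 * Real.pi)) = x n := by
    have hb : 1 - Real.cos θ + G (a n) = b n := by
      rw [hGk]
      simp only [β]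
      field_simp
      ring
    rw [shearedCircle, harg, hsin, hb, add_assoc, ← hframe (x n - p)]
    abel
  refine ⟨⟨_, hpt⟩, shearedCircle p v G, θ / (2 * Real.pi), hreg, rfl, hpt, ?_⟩
  rw [← (L n).mk_rep, Projectivization.mk_eq_mk_iff']
  refine ⟨alongCoord v (L n).rep / N / (2 * Real.pi * Real.cos θ), ?_⟩
  have hslope : Real.sin θ + deriv G (Real.sin θ) * Real.cos θ = m n * Real.cos θ := by
    rw [hsin, hGk', ← hsin]
    simp only [μ]
    rw [← hθ, Real.tan_eq_sin_div_cos]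
    field_simp
    ring
  rw [(hasDerivAt_shearedCircle p v hG _).deriv, harg, hslope]
  conv_rhs => rw [hframe (L n).rep]
  rw [smul_add, smul_smul, smul_smul]
  congr 2
  · field_simp
  · simp only [m]
    field_simp
end
end

section
/- Let f be a homeomorphism of ℝ² such that: (a) f maps every C¹ curve to a C¹ curve; (b) f induces a homeomorphism φ_q of projective tangent spaces at every point q ∈ ℝ²; and (c) for every transverse sequence (pₙ, kₙ), the sequence ((f(pₙ), φ_{pₙ}(kₙ))) is a transverse sequence. Then for every simple closed C¹ curve Γ, the function L : f⁻¹(Γ) → ℙ(ℝ²) assigning to each q ∈ f⁻¹(Γ) the unique ℓ ∈ ℙ(ℝ²) such that the secant directions [x − q] tend to ℓ as x → q within f⁻¹(Γ) \ {q} (such an ℓ exists) is continuous on f⁻¹(Γ). -/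
open Filter Topology

noncomputable section

theorem tendsto_mk {α : Type*} {l : Filter α} {u : α → Plane} {v : Plane} (hu : ∀ a, u a ≠ 0)
    (hv : v ≠ 0) (h : Tendsto u l (𝓝 v)) :
    Tendsto (fun a => (Projectivization.mk ℝ (u a) (hu a) : ProjLine)) l
      (𝓝 (Projectivization.mk ℝ v hv)) := by
  have hc : Continuous (fun w : {w : Plane // w ≠ 0} =>
      (Projectivization.mk ℝ w.1 w.2 : ProjLine)) := continuous_quotient_mk'
  have hs : Tendsto (fun a => (⟨u a, hu a⟩ : {w : Plane // w ≠ 0})) l (𝓝 ⟨v, hv⟩) :=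
    tendsto_subtype_rng.2 h
  exact (hc.tendsto ⟨v, hv⟩).comp hs

/-- The entries of the orthogonal projection onto the line spanned by `v`. -/
def lineProjection (v : Plane) : ℝ × ℝ × ℝ :=
  (v.1 ^ 2 / (v.1 ^ 2 + v.2 ^ 2), v.1 * v.2 / (v.1 ^ 2 + v.2 ^ 2), v.2 ^ 2 / (v.1 ^ 2 + v.2 ^ 2))

theorem lineProjection_smul {t : ℝ} (ht : t ≠ 0) (v : Plane) :
    lineProjection (t • v) = lineProjection v := by
  have h : (t * v.1) ^ 2 + (t * v.2) ^ 2 = t ^ 2 * (v.1 ^ 2 + v.2 ^ 2) := by ring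
  have ht2 : t ^ 2 ≠ 0 := pow_ne_zero 2 ht
  simp only [lineProjection, Prod.smul_fst, Prod.smul_snd, smul_eq_mul, h]
  refine Prod.ext ?_ (Prod.ext ?_ ?_) <;> simp only <;>
    rw [← mul_div_mul_left _ (v.1 ^ 2 + v.2 ^ 2) ht2] <;> congr 1 <;> ring

theorem mk_eq_mk_of_det_eq_zero {u v : Plane} (hu : u ≠ 0) (hv : v ≠ 0)
    (h : u.1 * v.2 - u.2 * v.1 = 0) :
    (Projectivization.mk ℝ u hu : ProjLine) = Projectivization.mk ℝ v hv := by
  have hv2 := sq_add_sq_ne_zero hv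
  rw [Projectivization.mk_eq_mk_iff']
  refine ⟨(u.1 * v.1 + u.2 * v.2) / (v.1 ^ 2 + v.2 ^ 2), ?_⟩
  ext
  · simp only [Prod.smul_fst, smul_eq_mul]
    field_simp
    linear_combination (-v.2) * h
  · simp only [Prod.smul_snd, smul_eq_mul]
    field_simp
    linear_combination (v.1) * h

instance : T2Space ProjLine := by
  let F : ProjLine → ℝ × ℝ × ℝ := Quotient.lift (fun v : {w : Plane // w ≠ 0} => lineProjection v)
    (by
      rintro ⟨a, ha⟩ ⟨b, hb⟩ ⟨t, ht⟩
      have : (t : ℝ) • b = a := ht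
      change lineProjection a = lineProjection b
      rw [← this, lineProjection_smul t.ne_zero])
  have hF : Continuous F := by
    refine Continuous.quotient_lift ?_ _
    have h0 : ∀ v : {w : Plane // w ≠ 0}, v.1.1 ^ 2 + v.1.2 ^ 2 ≠ 0 := fun v =>
      sq_add_sq_ne_zero v.2
    unfold lineProjection
    fun_prop (disch := exact h0 _)
  refine T2Space.of_injective_continuous (f := F) ?_ hF
  intro a b
  induction a using Projectivization.ind with | h u hu => ?_
  induction b using Projectivization.ind with | h v hv => ?_
  intro h
  have h' : lineProjection u = lineProjection v := h
  apply mk_eq_mk_of_det_eq_zero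
  have hu2 := sq_add_sq_ne_zero hu
  have hv2 := sq_add_sq_ne_zero hv
  simp only [lineProjection, Prod.mk.injEq] at h'
  obtain ⟨h1, h2, h3⟩ := h'
  rw [div_eq_div_iff hu2 hv2] at h1 h2 h3
  have key : (v.1 ^ 2 + v.2 ^ 2) * (u.1 * v.2 - u.2 * v.1) ^ 2 = 0 := by
    linear_combination v.2 ^ 2 * h1 - 2 * v.1 * v.2 * h2 + v.1 ^ 2 * h3
  simpa [hv2] using key

theorem exists_projLine_ne (ℓ : ProjLine) : ∃ k : ProjLine, k ≠ ℓ := by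
  by_contra! h
  have h1 := (h (Projectivization.mk ℝ ((1, 0) : Plane) (by simp))).trans
    (h (Projectivization.mk ℝ ((0, 1) : Plane) (by simp))).symm
  rw [Projectivization.mk_eq_mk_iff'] at h1
  obtain ⟨a, ha⟩ := h1
  simp at ha

namespace IsRegParam

variable {γ : ℝ → Plane}

theorem exists_int_of_eq (h : IsRegParam γ) {s t : ℝ} (hst : γ s = γ t) :
    ∃ n : ℤ, s = t + n := by
  have hf : ∀ r : ℝ, γ (Int.fract r) = γ r := fun r => by
    have := h.2.1.sub_int_mul_eq (x := r) ⌊r⌋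
    rwa [mul_one] at this
  have h1 : Int.fract s = Int.fract t := h.2.2.1 ⟨Int.fract_nonneg s, Int.fract_lt_one s⟩
    ⟨Int.fract_nonneg t, Int.fract_lt_one t⟩ (by rw [hf, hf, hst])
  obtain ⟨n, hn⟩ := Int.fract_eq_fract.1 h1
  exact ⟨n, by linarith⟩

theorem eq_of_abs_sub_lt_one (h : IsRegParam γ) {s t : ℝ} (hst : γ s = γ t)
    (hd : |s - t| < 1) : s = t := by
  obtain ⟨n, rfl⟩ := h.exists_int_of_eq hst
  rw [add_sub_cancel_left] at hd
  have : n = 0 := Int.abs_lt_one_iff.1 (by exact_mod_cast hd)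
  simp [this]

theorem exists_lift_tendsto (h : IsRegParam γ) {x : ℕ → Plane} (t₀ : ℝ)
    (hx : ∀ n, x n ∈ Set.range γ) (hlim : Tendsto x atTop (𝓝 (γ t₀))) :
    ∃ t : ℕ → ℝ, Tendsto t atTop (𝓝 t₀) ∧ ∀ n, γ (t n) = x n := by
  have hex : ∀ n, ∃ s ∈ Set.Icc (t₀ - 1 / 2) (t₀ + 1 / 2), γ s = x n := fun n => by
    obtain ⟨r, hr⟩ := hx n
    obtain ⟨s, hs, hs'⟩ := h.2.1.exists_mem_Ico one_pos r (t₀ - 1 / 2)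
    exact ⟨s, ⟨hs.1, by linarith [hs.2]⟩, by rw [← hs', hr]⟩
  choose t ht hγ using hex
  refine ⟨t, isCompact_Icc.tendsto_nhds_of_unique_mapClusterPt (Eventually.of_forall ht) ?_, hγ⟩
  intro s hs hc
  have h1 : MapClusterPt (γ s) atTop (γ ∘ t) := hc.continuousAt_comp h.1.continuous.continuousAt
  have h2 : γ ∘ t = x := funext hγ
  rw [h2] at h1
  have h3 : γ s = γ t₀ := by
    by_contra hne
    exact (disjoint_nhds_nhds.2 hne).mono_right hlim |>.eq_bot |> h1.neBot.ne
  refine h.eq_of_abs_sub_lt_one h3 ?_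
  rw [abs_lt]
  constructor <;> linarith [hs.1, hs.2]

theorem tendsto_secantDir (h : IsRegParam γ) {x : ℕ → Plane} (t₀ : ℝ)
    (hx : ∀ n, x n ∈ Set.range γ) (hne : ∀ n, x n ≠ γ t₀) (hlim : Tendsto x atTop (𝓝 (γ t₀))) :
    Tendsto (fun n => secantDir (γ t₀) (x n)) atTop
      (𝓝 (Projectivization.mk ℝ (deriv γ t₀) (h.2.2.2 t₀))) := by
  obtain ⟨t, ht, hγ⟩ := h.exists_lift_tendsto t₀ hx hlim
  have htne : ∀ n, t n ≠ t₀ := fun n hn => hne n (by rw [← hγ, hn])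
  have hd : HasDerivAt γ (deriv γ t₀) t₀ :=
    (h.1.differentiable one_ne_zero t₀).hasDerivAt
  have hs := (hasDerivAt_iff_tendsto_slope.1 hd).comp
    (tendsto_nhdsWithin_iff.2 ⟨ht, Eventually.of_forall htne⟩)
  have hsl : ∀ n, slope γ t₀ (t n) = (t n - t₀)⁻¹ • (x n - γ t₀) := fun n => by
    rw [slope_def_module, hγ]
  have hs0 : ∀ n, slope γ t₀ (t n) ≠ 0 := fun n => by
    rw [hsl]
    exact smul_ne_zero (inv_ne_zero (sub_ne_zero.2 (htne n))) (sub_ne_zero.2 (hne n))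
  refine (tendsto_mk hs0 (h.2.2.2 t₀) hs).congr fun n => ?_
  rw [secantDir, dif_neg (hne n), Projectivization.mk_eq_mk_iff']
  exact ⟨(t n - t₀)⁻¹, (hsl n).symm⟩

theorem exists_seq (h : IsRegParam γ) (t₀ : ℝ) :
    ∃ x : ℕ → Plane, (∀ n, x n ∈ Set.range γ) ∧ (∀ n, x n ≠ γ t₀) ∧
      Tendsto x atTop (𝓝 (γ t₀)) := by
  refine ⟨fun n => γ (t₀ + 1 / ((n + 1 : ℕ) + 1 : ℝ)), fun n => ⟨_, rfl⟩, fun n hn => ?_, ?_⟩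
  · have hpos : (0 : ℝ) < 1 / ((n + 1 : ℕ) + 1 : ℝ) := by positivity
    have hlt : 1 / ((n + 1 : ℕ) + 1 : ℝ) < 1 := by
      rw [div_lt_one (by positivity)]
      push_cast
      linarith [(Nat.cast_nonneg n : (0 : ℝ) ≤ n)]
    have := h.eq_of_abs_sub_lt_one hn (by rwa [add_sub_cancel_left, abs_of_pos hpos])
    linarith
  · refine (h.1.continuous.tendsto t₀).comp ?_
    have := (tendsto_add_atTop_iff_nat 1).2 (tendsto_one_div_add_atTop_nhds_zero_nat (𝕜 := ℝ))
    simpa using tendsto_const_nhds (x := t₀).add this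

end IsRegParam

theorem exists_tangentAt_s12 (q : Plane) (ℓ : ProjLine) : ∃ C : Set Plane, TangentAt C q ℓ := by
  induction ℓ using Projectivization.ind with | h v hv => ?_
  have hv2 := sq_add_sq_ne_zero hv
  let γ : ℝ → Plane := fun t =>
    (q.1 + Real.sin (2 * Real.pi * t) * v.1 - (1 - Real.cos (2 * Real.pi * t)) * v.2,
      q.2 + Real.sin (2 * Real.pi * t) * v.2 + (1 - Real.cos (2 * Real.pi * t)) * v.1)
  have hder : ∀ t, deriv γ t = (2 * Real.pi) •
      ((Real.cos (2 * Real.pi * t) * v.1 - Real.sin (2 * Real.pi * t) * v.2,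
        Real.cos (2 * Real.pi * t) * v.2 + Real.sin (2 * Real.pi * t) * v.1) : Plane) := by
    intro t
    have hl : HasDerivAt (fun t : ℝ => 2 * Real.pi * t) (2 * Real.pi) t := by
      simpa using (hasDerivAt_id t).const_mul (2 * Real.pi)
    have hs := hl.sin
    have hc := (hl.cos).const_sub 1
    have h1 := ((hs.mul_const v.1).const_add q.1).sub (hc.mul_const v.2)
    have h2 := ((hs.mul_const v.2).const_add q.2).add (hc.mul_const v.1)
    rw [show deriv γ t = _ from (h1.prodMk h2).deriv]
    ext
    · simp only [Prod.smul_fst, smul_eq_mul]; ring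
    · simp only [Prod.smul_snd, smul_eq_mul]; ring
  have hreg : IsRegParam γ := by
    refine ⟨by fun_prop, fun t => ?_, ?_, fun t => ?_⟩
    · simp only [γ, mul_add, mul_one, Real.sin_add_two_pi, Real.cos_add_two_pi]
    · intro s hs t ht hst
      simp only [γ, Prod.mk.injEq] at hst
      obtain ⟨h1, h2⟩ := hst
      have hsin : Real.sin (2 * Real.pi * s) = Real.sin (2 * Real.pi * t) := by
        refine mul_left_cancel₀ hv2 ?_
        linear_combination v.1 * h1 + v.2 * h2
      have hcos : Real.cos (2 * Real.pi * s) = Real.cos (2 * Real.pi * t) := by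
        refine mul_left_cancel₀ hv2 ?_
        linear_combination v.2 * h1 - v.1 * h2
      have hang := Real.Angle.cos_sin_inj hcos hsin
      obtain ⟨n, hn⟩ := Real.Angle.angle_eq_iff_two_pi_dvd_sub.1 hang
      have hn' : s - t = n := by
        refine mul_left_cancel₀ Real.two_pi_pos.ne' ?_
        linear_combination hn
      have : n = 0 := by
        refine Int.abs_lt_one_iff.1 ?_
        have : |(n : ℝ)| < 1 := by
          rw [← hn', abs_lt]
          constructor <;> linarith [hs.1, hs.2, ht.1, ht.2]
        exact_mod_cast this
      rw [this, Int.cast_zero] at hn'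
      linarith
    · rw [hder]
      refine smul_ne_zero Real.two_pi_pos.ne' fun h0 => hv2 ?_
      obtain ⟨h1, h2⟩ := Prod.mk.inj h0
      have := Real.sin_sq_add_cos_sq (2 * Real.pi * t)
      linear_combination (Real.cos (2 * Real.pi * t) * v.1 - Real.sin (2 * Real.pi * t) * v.2) * h1
        + (Real.cos (2 * Real.pi * t) * v.2 + Real.sin (2 * Real.pi * t) * v.1) * h2
        - (v.1 ^ 2 + v.2 ^ 2) * this
  refine ⟨Set.range γ, γ, 0, hreg, rfl, by simp [γ], ?_⟩
  rw [eq_comm, Projectivization.mk_eq_mk_iff']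
  exact ⟨2 * Real.pi, by rw [hder]; simp⟩

theorem tendsto_interleave {α : Type*} {l : Filter α} {u v : ℕ → α} (hu : Tendsto u atTop l)
    (hv : Tendsto v atTop l) :
    Tendsto (fun n => if n % 2 = 0 then u (n / 2) else v (n / 2)) atTop l := by
  have h2 : Tendsto (fun n : ℕ => n / 2) atTop atTop := Nat.tendsto_div_const_atTop two_ne_zero
  exact (hu.comp h2).if' (hv.comp h2)

theorem convAlong_image (f : Plane ≃ₜ Plane) (φ : Plane → (ProjLine ≃ₜ ProjLine))
    (hφ : ∀ q : Plane, InducesAt ⇑f q (φ q))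
    (htrans : ∀ (x : ℕ → Plane) (k : ℕ → ProjLine), Transverse x k →
      Transverse (fun n => f (x n)) (fun n => φ (x n) (k n)))
    {q : Plane} {ℓ : ProjLine} {x : ℕ → Plane} (hx : ConvAlong q ℓ x) :
    ConvAlong (f q) (φ q ℓ) (fun n => f (x n)) := by
  obtain ⟨C, hC⟩ := exists_tangentAt_s12 q ℓ
  obtain ⟨γ, t₀, hγ, rfl, rfl, rfl⟩ := id hC
  obtain ⟨y, hy, hyne, hylim⟩ := hγ.exists_seq t₀
  have hysec := hγ.tendsto_secantDir t₀ hy hyne hylim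
  set ℓ : ProjLine := Projectivization.mk ℝ (deriv γ t₀) (hγ.2.2.2 t₀)
  set q := γ t₀
  obtain ⟨k, hk⟩ := exists_projLine_ne ℓ
  let z : ℕ → Plane := fun n => if n % 2 = 0 then x (n / 2) else y (n / 2)
  have hz0 : ∀ n, z (2 * n) = x n := fun n => by simp [z]
  have hz1 : ∀ n, z (2 * n + 1) = y n := fun n => by
    simp [z, Nat.add_mod, show (2 * n + 1) / 2 = n by omega]
  have hz : Transverse z (fun _ => k) := by
    refine ⟨q, ℓ, ⟨fun n => ?_, tendsto_interleave hx.2.1 hylim, ?_⟩, fun ψ _ h => ?_⟩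
    · by_cases h : n % 2 = 0
      · simpa [z, h] using hx.1 _
      · simpa [z, h] using hyne _
    · refine (tendsto_interleave hx.2.2 hysec).congr fun n => ?_
      exact (apply_ite (secantDir q) _ _ _).symm
    · exact hk (tendsto_nhds_unique tendsto_const_nhds h.snd_nhds)
  obtain ⟨p', ℓ', ⟨-, hlim, hsec⟩, -⟩ := htrans z _ hz
  have heven : Tendsto (fun n : ℕ => 2 * n) atTop atTop :=
    tendsto_atTop_mono (fun n => by dsimp only [id]; lia) tendsto_id
  have hodd : Tendsto (fun n : ℕ => 2 * n + 1) atTop atTop := 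
    tendsto_atTop_mono (fun n => by dsimp only [id]; lia) tendsto_id
  have hfx : Tendsto (fun n => f (x n)) atTop (𝓝 (f q)) := (f.continuous.tendsto q).comp hx.2.1
  have hfy : Tendsto (fun n => f (y n)) atTop (𝓝 (f q)) := (f.continuous.tendsto q).comp hylim
  have hp : p' = f q := by
    refine tendsto_nhds_unique ((hlim.comp heven).congr fun n => ?_) hfx
    simp [hz0]
  subst hp
  have hℓ : ℓ' = φ q ℓ := by
    obtain ⟨-, γ', s₀, hγ', hrange, hs₀, htan⟩ := hφ q _ _ hC
    rw [htan]
    refine tendsto_nhds_unique ((hsec.comp hodd).congr fun n => ?_)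
      (hs₀ ▸ hγ'.tendsto_secantDir s₀ (x := fun n => f (y n)) (fun n => ?_) (fun n => ?_) ?_)
    · simp [hz1]
    · rw [← hrange]; exact Set.mem_image_of_mem f (hy n)
    · rw [hs₀]; exact f.injective.ne (hyne n)
    · rwa [hs₀]
  subst hℓ
  refine ⟨fun n => f.injective.ne (hx.1 n), hfx, (hsec.comp heven).congr fun n => ?_⟩
  simp [hz0]

/-- Under properties (a), (b), (c), any function assigning to each point of the preimage
of a C¹ curve its (unique) tangent line is continuous on the preimage. -/
theorem preimage_tangent_lines_continuous (f : Plane ≃ₜ Plane)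
    (hmaps : MapsC1 ⇑f)
    (φ : Plane → (ProjLine ≃ₜ ProjLine)) (hφ : ∀ q : Plane, InducesAt ⇑f q (φ q))
    (htrans : ∀ (x : ℕ → Plane) (k : ℕ → ProjLine), Transverse x k →
      Transverse (fun n => f (x n)) (fun n => φ (x n) (k n)))
    (Γ : Set Plane) (hΓ : IsC1Curve Γ)
    (L : Plane → ProjLine)
    (hL : ∀ q ∈ ⇑f ⁻¹' Γ, Tendsto (secantDir q) (𝓝[(⇑f ⁻¹' Γ) \ {q}] q) (𝓝 (L q))) :
    ContinuousOn L (⇑f ⁻¹' Γ) := by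
  obtain ⟨γ, hγ, rfl⟩ := hΓ
  have htan : ∀ (q : Plane) (t : ℝ), γ t = f q →
      φ q (L q) = Projectivization.mk ℝ (deriv γ t) (hγ.2.2.2 t) := by
    intro q t ht
    obtain ⟨y, hy, hyne, hylim⟩ := hγ.exists_seq t
    have hqy : f.symm (γ t) = q := by rw [ht, f.symm_apply_apply]
    have hxne : ∀ n, f.symm (y n) ≠ q := fun n h => hyne n (by rw [ht, ← h, f.apply_symm_apply])
    have hxlim : Tendsto (fun n => f.symm (y n)) atTop (𝓝 q) :=
      hqy ▸ (f.symm.continuous.tendsto (γ t)).comp hylim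
    have hx : ConvAlong q (L q) (fun n => f.symm (y n)) := by
      refine ⟨hxne, hxlim, (hL q ⟨t, ht⟩).comp (tendsto_nhdsWithin_iff.2
        ⟨hxlim, Eventually.of_forall fun n => ⟨?_, hxne n⟩⟩)⟩
      simpa using hy n
    have h1 := (convAlong_image f φ hφ htrans hx).2.2
    simp only [f.apply_symm_apply, ← ht] at h1
    exact tendsto_nhds_unique h1 (hγ.tendsto_secantDir t hy hyne hylim)
  intro q hq
  by_contra hcont
  obtain ⟨U, hU, hnot⟩ := not_tendsto_iff_exists_frequently_notMem.1 hcont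
  obtain ⟨x, hxlim, hxU⟩ := exists_seq_forall_of_frequently hnot
  have hxne : ∀ n, x n ≠ q := fun n h => hxU n (h ▸ mem_of_mem_nhds hU)
  obtain ⟨hxlim, hxmem⟩ := tendsto_nhdsWithin_iff.1 hxlim
  obtain ⟨N, hN⟩ := eventually_atTop.1 hxmem
  have hylim := (tendsto_add_atTop_iff_nat N).2 hxlim
  have hmem : ∀ n, x (n + N) ∈ f ⁻¹' Set.range γ := fun n => hN _ (Nat.le_add_left N n)
  have hconv : ConvAlong q (L q) (fun n => x (n + N)) :=
    ⟨fun n => hxne _, hylim, (hL q hq).comp (tendsto_nhdsWithin_iff.2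
      ⟨hylim, Eventually.of_forall fun n => ⟨hmem n, hxne _⟩⟩)⟩
  obtain ⟨p', ℓ', ⟨-, hlim', hsec'⟩, hno⟩ := htrans _ (fun n => L (x (n + N)))
    ⟨q, L q, hconv, fun ψ _ h => by
      obtain ⟨n, hn⟩ := (h.snd_nhds.eventually hU).exists
      exact hxU _ hn⟩
  obtain ⟨-, hflim, hfsec⟩ := convAlong_image f φ hφ htrans hconv
  obtain rfl := tendsto_nhds_unique hlim' hflim
  obtain rfl := tendsto_nhds_unique hsec' hfsec
  obtain ⟨t₀, ht₀⟩ := hq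
  obtain ⟨t, ht, hγt⟩ := hγ.exists_lift_tendsto t₀ hmem (by rwa [ht₀])
  refine hno id strictMono_id (hlim'.prodMk_nhds ?_)
  rw [htan q t₀ ht₀]
  refine (tendsto_mk (fun n => hγ.2.2.2 (t n)) (hγ.2.2.2 t₀)
    (((hγ.1.continuous_deriv le_rfl).tendsto t₀).comp ht)).congr fun n => ?_
  exact (htan _ _ (hγt n)).symm
end
end
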